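/- For every Θ > 0 there exist k > 0 and ε ∈ (0, m_Θ) such that, with A_{k,ε} = {(u,v) ∈ S_Θ × S_Θ : ‖∇_x u‖₂² + ‖∇_x v‖₂² < k and ‖u_y‖₂² + ‖v_y‖₂² ≤ 2(m_Θ − ε)}, Γ(Θ) = {g ∈ C([0,1]; S_Θ × S_Θ) : g(0) ∈ A_{k,ε} and I(g(1)) < 0}, and the mountain-pass level γ_Θ = inf_{g ∈ Γ(Θ)} max_{t ∈ [0,1]} I(g(t)), one has γ_Θ = m_Θ and moreover γ_Θ > max{ sup_{g ∈ Γ(Θ)} I(g(0)), sup_{g ∈ Γ(Θ)} I(g(1)) }, i.e. I has a mountain-pass geometry on S_Θ × S_Θ at level m_Θ. -/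

import Mathlib

noncomputable section

open MeasureTheory Real Filter

namespace Waveguide

/-- A point of the waveguide `ℝ³ × 𝕋`, modelled as `ℝ³ × ℝ` with functions that are
`2π`-periodic in the second coordinate. -/
abbrev Pt : Type := (Fin 3 → ℝ) × ℝ

/-- The fundamental domain `ℝ³ × (0, 2π]` of the waveguide `ℝ³ × 𝕋`. -/
def Dom : Set Pt := Set.univ ×ˢ Set.Ioc 0 (2 * π)

/-- `2π`-periodicity in the `y` variable. -/
def PeriodicY (u : Pt → ℝ) : Prop := ∀ x y, u (x, y + 2 * π) = u (x, y)

/-- The `i`-th horizontal coordinate direction. -/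
def ex (i : Fin 3) : Pt := (fun j => if j = i then 1 else 0, 0)

/-- The vertical (periodic) direction. -/
def ey : Pt := (0, 1)

/-- `i`-th partial derivative in the `x` variables. -/
def gradx (u : Pt → ℝ) (p : Pt) (i : Fin 3) : ℝ := fderiv ℝ u p (ex i)

/-- Partial derivative in the `y` variable, `u_y`. -/
def grady (u : Pt → ℝ) (p : Pt) : ℝ := fderiv ℝ u p ey

/-- `|∇_x u|²`. -/
def gradSqX (u : Pt → ℝ) (p : Pt) : ℝ := ∑ i, (gradx u p i) ^ 2

/-- `|∇_{x,y} u|²`. -/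
def gradSq (u : Pt → ℝ) (p : Pt) : ℝ := gradSqX u p + (grady u p) ^ 2

/-- Membership in (a regular repesentative of) `H¹(ℝ³ × 𝕋)`, for real valued functions. -/
structure H1 (u : Pt → ℝ) : Prop where
  periodic : PeriodicY u
  diff : Differentiable ℝ u
  memL2 : IntegrableOn (fun p => (u p) ^ 2) Dom
  memGrad : IntegrableOn (fun p => gradSq u p) Dom
  memL4 : IntegrableOn (fun p => (u p) ^ 4) Dom

/-- The `L²(ℝ³ × 𝕋)` norm. -/
def l2 (u : Pt → ℝ) : ℝ := Real.sqrt (∫ p in Dom, (u p) ^ 2)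

/-- `u ∈ S_Θ`. -/
def inS (Θ : ℝ) (u : Pt → ℝ) : Prop := H1 u ∧ l2 u = Θ

/-- The nonlinear density `u⁴ + 2u²v² + v⁴`. -/
def nonlin (u v : Pt → ℝ) (p : Pt) : ℝ :=
  (u p) ^ 4 + 2 * (u p) ^ 2 * (v p) ^ 2 + (v p) ^ 4

/-- The energy functional `I(u,v)`. -/
def energy (u v : Pt → ℝ) : ℝ :=
  (1 / 2) * (∫ p in Dom, (gradSq u p + gradSq v p))
    - (1 / 4) * ∫ p in Dom, nonlin u v p

/-- The semivirial functional `Q(u,v)`. -/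
def svirial (u v : Pt → ℝ) : ℝ :=
  (∫ p in Dom, (gradSqX u p + gradSqX v p))
    - (3 / 4) * ∫ p in Dom, nonlin u v p

/-- The ground-state level `m_Θ`. -/
def mlevel (Θ : ℝ) : ℝ :=
  sInf {c | ∃ u v : Pt → ℝ, inS Θ u ∧ inS Θ v ∧ svirial u v = 0 ∧ energy u v = c}

/-- `(u,v)` is a minimizer of `m_Θ`: it lies in `V_Θ` and attains the infimum. -/
def isMinimizer (Θ : ℝ) (u v : Pt → ℝ) : Prop :=
  inS Θ u ∧ inS Θ v ∧ svirial u v = 0 ∧ energy u v = mlevel Θ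

/-- Smooth, compactly supported (in `x`) test function on the waveguide. -/
def TestFun (φ : Pt → ℝ) : Prop :=
  ContDiff ℝ (⊤ : ℕ∞) φ ∧ PeriodicY φ ∧
    ∃ K : Set (Fin 3 → ℝ), IsCompact K ∧ ∀ p : Pt, p.1 ∉ K → φ p = 0

/-- `u` is a weak solution of `-Δ_{x,y} u + lam u = f` on `ℝ³ × 𝕋`. -/
def WeakSol (lam : ℝ) (u f : Pt → ℝ) : Prop :=
  ∀ φ : Pt → ℝ, TestFun φ →
    (∫ p in Dom,
        ((∑ i, gradx u p i * gradx φ p i) + grady u p * grady φ p + lam * u p * φ p))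
      = ∫ p in Dom, f p * φ p

/-- The mass-preserving rescaling `u^τ(x,y) = τ^{3/2} u(τx, y)`. -/
def scaleX (τ : ℝ) (u : Pt → ℝ) : Pt → ℝ :=
  fun p => τ ^ ((3 : ℝ) / 2) * u (τ • p.1, p.2)

/-- `u` is independent of the `y` variable, i.e. `u_y = 0` (a.e.). -/
def Yindep (u : Pt → ℝ) : Prop := ∀ᵐ p : Pt ∂volume, grady u p = 0

/-- The functional `J_μ(u,v)`. -/
def Jfun (μ : ℝ) (u v : Pt → ℝ) : ℝ :=
  (1 / 2) * (∫ p in Dom,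
      (gradSqX u p + μ * (grady u p) ^ 2 + gradSqX v p + μ * (grady v p) ^ 2))
    - (1 / 4) * ∫ p in Dom, nonlin u v p

/-- The level `m_{1,μ}`. -/
def m1 (μ : ℝ) : ℝ :=
  sInf {c | ∃ u v : Pt → ℝ, inS 1 u ∧ inS 1 v ∧ svirial u v = 0 ∧ Jfun μ u v = c}

/-- `(u,v)` is a minimizer of `m_{1,μ}`. -/
def isMinimizerJ (μ : ℝ) (u v : Pt → ℝ) : Prop :=
  inS 1 u ∧ inS 1 v ∧ svirial u v = 0 ∧ Jfun μ u v = m1 μ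

/-! ### Objects on `ℝ³` -/

abbrev Pt3 : Type := Fin 3 → ℝ

def e3 (i : Fin 3) : Pt3 := fun j => if j = i then 1 else 0

def grad3 (w : Pt3 → ℝ) (x : Pt3) (i : Fin 3) : ℝ := fderiv ℝ w x (e3 i)

def gradSq3 (w : Pt3 → ℝ) (x : Pt3) : ℝ := ∑ i, (grad3 w x i) ^ 2

/-- Membership in (a regular representative of) `H¹(ℝ³)`. -/
structure H1R3 (w : Pt3 → ℝ) : Prop where
  diff : Differentiable ℝ w
  memL2 : Integrable (fun x => (w x) ^ 2)
  memGrad : Integrable (fun x => gradSq3 w x)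
  memL4 : Integrable (fun x => (w x) ^ 4)

/-- The `L²(ℝ³)` norm. -/
def l2R3 (w : Pt3 → ℝ) : ℝ := Real.sqrt (∫ x, (w x) ^ 2)

def nonlin3 (u v : Pt3 → ℝ) (x : Pt3) : ℝ :=
  (u x) ^ 4 + 2 * (u x) ^ 2 * (v x) ^ 2 + (v x) ^ 4

/-- The limit energy `Î(u,v)` on `ℝ³`. -/
def Ihat (u v : Pt3 → ℝ) : ℝ :=
  (1 / 2) * (∫ x, (gradSq3 u x + gradSq3 v x)) - (1 / 4) * ∫ x, nonlin3 u v x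

/-- The virial `Q̂(u,v)` on `ℝ³`. -/
def Qhat (u v : Pt3 → ℝ) : ℝ :=
  (∫ x, (gradSq3 u x + gradSq3 v x)) - (3 / 4) * ∫ x, nonlin3 u v x

/-- The ground-state energy `m̂_ρ` on `ℝ³`. -/
def mhat (ρ : ℝ) : ℝ :=
  sInf {c | ∃ u v : Pt3 → ℝ, H1R3 u ∧ H1R3 v ∧ l2R3 u = ρ ∧ l2R3 v = ρ ∧
    Qhat u v = 0 ∧ Ihat u v = c}


/-! ### Mountain-pass structures -/

/-- The set `A_{k,ε}`. -/
def Aset (Θ k ε : ℝ) : Set ((Pt → ℝ) × (Pt → ℝ)) :=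
  {uv | inS Θ uv.1 ∧ inS Θ uv.2 ∧
    (∫ p in Dom, gradSqX uv.1 p) + (∫ p in Dom, gradSqX uv.2 p) < k ∧
    (∫ p in Dom, (grady uv.1 p) ^ 2) + (∫ p in Dom, (grady uv.2 p) ^ 2)
      ≤ 2 * (mlevel Θ - ε)}

/-- The `H¹(ℝ³ × 𝕋)` distance between two functions. -/
def h1dist (u v : Pt → ℝ) : ℝ :=
  Real.sqrt (∫ p in Dom, ((u p - v p) ^ 2 + gradSq (fun q => u q - v q) p))

/-- Continuity of a path `[0,1] → S_Θ × S_Θ` with respect to the `H¹ × H¹` distance. -/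
def PathCont (g : ℝ → (Pt → ℝ) × (Pt → ℝ)) : Prop :=
  ∀ t ∈ Set.Icc (0 : ℝ) 1, ∀ ε : ℝ, 0 < ε → ∃ δ : ℝ, 0 < δ ∧
    ∀ s ∈ Set.Icc (0 : ℝ) 1, |s - t| < δ →
      h1dist (g s).1 (g t).1 < ε ∧ h1dist (g s).2 (g t).2 < ε

/-- The admissible class of paths `Γ(Θ)` (depending on `k, ε`). -/
def Gam (Θ k ε : ℝ) : Set (ℝ → (Pt → ℝ) × (Pt → ℝ)) :=
  {g | PathCont g ∧ (∀ t ∈ Set.Icc (0 : ℝ) 1, inS Θ (g t).1 ∧ inS Θ (g t).2) ∧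
    g 0 ∈ Aset Θ k ε ∧ energy (g 1).1 (g 1).2 < 0}

/-- `max_{t ∈ [0,1]} I(g(t))`. -/
def pathMax (g : ℝ → (Pt → ℝ) × (Pt → ℝ)) : ℝ :=
  sSup {c | ∃ t ∈ Set.Icc (0 : ℝ) 1, energy (g t).1 (g t).2 = c}

/-- The mountain-pass level `γ_Θ`. -/
def gammaLevel (Θ k ε : ℝ) : ℝ :=
  sInf {c | ∃ g ∈ Gam Θ k ε, pathMax g = c}

/-! ### An anisotropic Gagliardo–Nirenberg inequality -/

/-- Lebesgue measure on the fundamental domain. -/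
abbrev domMeasure : Measure Pt := volume.restrict Dom

lemma domMeasure_eq :
    domMeasure = (volume : Measure (Fin 3 → ℝ)).prod (volume.restrict (Set.Ioc 0 (2 * π))) := by
  rw [domMeasure, Dom, Measure.volume_eq_prod, ← Measure.prod_restrict, Measure.restrict_univ]

lemma ofReal_abs_cube_le_add {φ : ℝ → ℝ} (hφ : Differentiable ℝ φ) {a b r s : ℝ}
    (hr : r ∈ Set.Icc a b) (hs : s ∈ Set.Icc a b) :
    ENNReal.ofReal (|φ s| ^ 3) ≤ ENNReal.ofReal (|φ r| ^ 3) +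
      ∫⁻ t in Set.Ioc a b, ENNReal.ofReal (3 * φ t ^ 2 * |deriv φ t|) := by
  have hsub : Set.uIoc r s ⊆ Set.Ioc a b := by
    intro t ht
    rw [Set.mem_uIoc] at ht
    rcases ht with ht | ht
    · exact ⟨lt_of_le_of_lt hr.1 ht.1, ht.2.trans hs.2⟩
    · exact ⟨lt_of_le_of_lt hs.1 ht.1, ht.2.trans hr.2⟩
  have hmeas : Measurable (fun t => 3 * φ t ^ 2 * deriv φ t) :=
    ((hφ.continuous.measurable.pow_const 2).const_mul 3).mul (measurable_deriv φ)
  have hen : ∀ t, ‖3 * φ t ^ 2 * deriv φ t‖ₑ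
      = ENNReal.ofReal (3 * φ t ^ 2 * |deriv φ t|) := by
    intro t
    rw [← ofReal_norm, Real.norm_eq_abs, abs_mul, abs_of_nonneg (by positivity)]
  by_cases hD : ∫⁻ t in Set.Ioc a b, ENNReal.ofReal (3 * φ t ^ 2 * |deriv φ t|) = ⊤
  · rw [hD]; simp
  have hInt : IntegrableOn (fun t => 3 * φ t ^ 2 * deriv φ t) (Set.Ioc a b) := by
    refine ⟨hmeas.aestronglyMeasurable, ?_⟩
    rw [hasFiniteIntegral_iff_enorm]
    simp_rw [hen]
    exact lt_top_iff_ne_top.2 hD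
  have hftc : ∫ t in r..s, 3 * φ t ^ 2 * deriv φ t = φ s ^ 3 - φ r ^ 3 := by
    refine intervalIntegral.integral_eq_sub_of_hasDerivAt (f := fun t => φ t ^ 3) ?_ ?_
    · intro t _
      simpa using (hφ t).hasDerivAt.fun_pow 3
    · rw [intervalIntegrable_iff]
      exact hInt.mono_set hsub
  have hle : ‖φ s ^ 3 - φ r ^ 3‖ₑ
      ≤ ∫⁻ t in Set.Ioc a b, ENNReal.ofReal (3 * φ t ^ 2 * |deriv φ t|) := by
    rw [← hftc]
    have h1 : ‖∫ t in r..s, 3 * φ t ^ 2 * deriv φ t‖ₑ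
        = ‖∫ t in Set.uIoc r s, 3 * φ t ^ 2 * deriv φ t‖ₑ := by
      rw [← ofReal_norm, ← ofReal_norm,
        intervalIntegral.norm_intervalIntegral_eq]
    rw [h1]
    refine (enorm_integral_le_lintegral_enorm _).trans ?_
    simp_rw [hen]
    exact lintegral_mono_set hsub
  have h3 : ∀ t, ENNReal.ofReal (|φ t| ^ 3) = ‖φ t ^ 3‖ₑ := by
    intro t
    rw [← ofReal_norm, Real.norm_eq_abs, abs_pow]
  rw [h3, h3]
  calc ‖φ s ^ 3‖ₑ = ‖φ r ^ 3 + (φ s ^ 3 - φ r ^ 3)‖ₑ := by congr 1; ring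
    _ ≤ ‖φ r ^ 3‖ₑ + ‖φ s ^ 3 - φ r ^ 3‖ₑ := enorm_add_le _ _
    _ ≤ _ := by gcongr

lemma ofReal_abs_cube_le_lintegral {φ : ℝ → ℝ} (hφ : Differentiable ℝ φ) {a b s : ℝ}
    (hab : a < b) (hs : s ∈ Set.Icc a b) :
    ENNReal.ofReal (|φ s| ^ 3) ≤ ∫⁻ t in Set.Ioc a b,
      ENNReal.ofReal (|φ t| ^ 3 / (b - a) + 3 * φ t ^ 2 * |deriv φ t|) := by
  have hba : 0 < b - a := sub_pos.2 hab
  set c : ENNReal := ENNReal.ofReal (b - a)⁻¹ with hc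
  have hcv : c * volume (Set.Ioc a b) = 1 := by
    rw [Real.volume_Ioc, hc, ← ENNReal.ofReal_mul (by positivity), inv_mul_cancel₀ hba.ne',
      ENNReal.ofReal_one]
  set D := ∫⁻ t in Set.Ioc a b, ENNReal.ofReal (3 * φ t ^ 2 * |deriv φ t|) with hD
  have hm : Measurable fun t => ENNReal.ofReal (|φ t| ^ 3) :=
    ((continuous_abs.comp hφ.continuous).pow 3).measurable.ennreal_ofReal
  calc ENNReal.ofReal (|φ s| ^ 3)
      = ∫⁻ _ in Set.Ioc a b, c * ENNReal.ofReal (|φ s| ^ 3) := by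
        rw [setLIntegral_const, mul_right_comm, hcv, one_mul]
    _ ≤ ∫⁻ r in Set.Ioc a b, (c * ENNReal.ofReal (|φ r| ^ 3) + c * D) := by
        refine setLIntegral_mono' measurableSet_Ioc fun r hr => ?_
        rw [← mul_add]
        gcongr
        exact ofReal_abs_cube_le_add hφ (Set.Ioc_subset_Icc_self hr) hs
    _ = (∫⁻ r in Set.Ioc a b, c * ENNReal.ofReal (|φ r| ^ 3)) + D := by
        rw [lintegral_add_right _ measurable_const, setLIntegral_const, mul_right_comm, hcv,
          one_mul]
    _ = _ := by
        rw [hD, ← lintegral_add_left (hm.const_mul c)]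
        refine lintegral_congr fun t => ?_
        rw [hc, ← ENNReal.ofReal_mul (by positivity), ← ENNReal.ofReal_add (by positivity)
          (by positivity)]
        congr 1
        rw [div_eq_inv_mul]

/-- A Loomis–Whitney type inequality on the fundamental domain, with different majorants in the
horizontal directions and in the vertical one. -/
lemma lintegral_rpow_le_of_line_bounds {U f₁ f₂ : Pt → ENNReal}
    (hf₁ : Measurable f₁) (hf₂ : Measurable f₂)
    (h₁ : ∀ x y i, U (x, y) ≤ ∫⁻ t : ℝ, f₁ (Function.update x i t, y))
    (h₂ : ∀ x, ∀ y ∈ Set.Ioc 0 (2 * π), U (x, y) ≤ ∫⁻ s in Set.Ioc 0 (2 * π), f₂ (x, s))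
    {c : ENNReal} (hc0 : c ≠ 0) (hct : c ≠ ⊤) :
    ∫⁻ p in Dom, U p ^ (4 / 3 : ℝ) ≤ c⁻¹ ^ (1 / 3 : ℝ) *
      (c * (∫⁻ p in Dom, f₂ p) + ∫⁻ p in Dom, f₁ p) ^ (4 / 3 : ℝ) := by
  set ν : Measure ℝ := volume.restrict (Set.Ioc 0 (2 * π)) with hν
  set H : (Fin 3 → ℝ) → ENNReal := fun x => ∫⁻ s, f₂ (x, s) ∂ν with hH
  set K : (Fin 3 → ℝ) → ENNReal := fun x => ∫⁻ s, f₁ (x, s) ∂ν with hK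
  have hHm : Measurable H := hf₂.lintegral_prod_right'
  have hKm : Measurable K := hf₁.lintegral_prod_right'
  set F : (Fin 3 → ℝ) → ENNReal := fun x => c * H x + K x with hF
  have hFm : Measurable F := (hHm.const_mul c).add hKm
  have hFint : ∫⁻ x, F x = c * (∫⁻ p in Dom, f₂ p) + ∫⁻ p in Dom, f₁ p := by
    change ∫⁻ x, F x = c * (∫⁻ p, f₂ p ∂domMeasure) + ∫⁻ p, f₁ p ∂domMeasure
    rw [domMeasure_eq, lintegral_prod _ hf₂.aemeasurable, lintegral_prod _ hf₁.aemeasurable,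
      lintegral_add_left (hHm.const_mul c), lintegral_const_mul _ hHm]
  have hmU : ∀ (x : Fin 3 → ℝ) (i : Fin 3),
      Measurable fun q : ℝ × ℝ => f₁ (Function.update x i q.1, q.2) := by
    intro x i
    exact hf₁.comp (((measurable_update x).comp measurable_fst).prodMk measurable_snd)
  have hpt : ∀ x, ∀ y ∈ Set.Ioc 0 (2 * π), U (x, y) ^ (4 / 3 : ℝ) ≤
      H x ^ (1 / 3 : ℝ) * ∏ i, (∫⁻ t : ℝ, f₁ (Function.update x i t, y)) ^ (1 / 3 : ℝ) := by
    intro x y hy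
    have e : U (x, y) ^ (4 / 3 : ℝ)
        = U (x, y) ^ (1 / 3 : ℝ) * ∏ _i : Fin 3, U (x, y) ^ (1 / 3 : ℝ) := by
      rw [Finset.prod_const, Finset.card_univ, Fintype.card_fin, ← ENNReal.rpow_natCast,
        ← ENNReal.rpow_mul, ← ENNReal.rpow_add_of_nonneg _ _ (by norm_num) (by norm_num)]
      norm_num
    rw [e]
    refine mul_le_mul' (ENNReal.rpow_le_rpow (h₂ x y hy) (by norm_num)) ?_
    exact Finset.prod_le_prod' fun i _ => ENNReal.rpow_le_rpow (h₁ x y i) (by norm_num)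
  have hx : ∀ x, ∫⁻ y, U (x, y) ^ (4 / 3 : ℝ) ∂ν ≤
      H x ^ (1 / 3 : ℝ) * ∏ i, (∫⁻ t : ℝ, K (Function.update x i t)) ^ (1 / 3 : ℝ) := by
    intro x
    have hGm : ∀ i, Measurable fun y => ∫⁻ t : ℝ, f₁ (Function.update x i t, y) := fun i =>
      Measurable.lintegral_prod_left' (f := fun q : ℝ × ℝ => f₁ (Function.update x i q.1, q.2))
        (hmU x i)
    calc ∫⁻ y, U (x, y) ^ (4 / 3 : ℝ) ∂ν
        ≤ ∫⁻ y, H x ^ (1 / 3 : ℝ) *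
            ∏ i, (∫⁻ t : ℝ, f₁ (Function.update x i t, y)) ^ (1 / 3 : ℝ) ∂ν :=
          setLIntegral_mono' measurableSet_Ioc fun y hy => hpt x y hy
      _ = H x ^ (1 / 3 : ℝ) *
            ∫⁻ y, ∏ i, (∫⁻ t : ℝ, f₁ (Function.update x i t, y)) ^ (1 / 3 : ℝ) ∂ν := by
          rw [lintegral_const_mul]
          exact Finset.measurable_prod _ fun i _ => (hGm i).pow_const _
      _ ≤ H x ^ (1 / 3 : ℝ) *
            ∏ i, (∫⁻ y, (∫⁻ t : ℝ, f₁ (Function.update x i t, y)) ∂ν) ^ (1 / 3 : ℝ) := by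
          gcongr
          exact ENNReal.lintegral_prod_norm_pow_le Finset.univ (p := fun _ => 1 / 3)
            (fun i _ => (hGm i).aemeasurable) (by norm_num) (by intros; norm_num)
      _ = _ := by
          congr 1
          refine Finset.prod_congr rfl fun i _ => ?_
          congr 1
          exact (lintegral_lintegral_swap (f := fun (t : ℝ) y => f₁ (Function.update x i t, y))
            (hmU x i).aemeasurable).symm
  have hmain : ∫⁻ p in Dom, U p ^ (4 / 3 : ℝ) ≤ ∫⁻ x, H x ^ (1 / 3 : ℝ) *
      ∏ i, (∫⁻ t : ℝ, K (Function.update x i t)) ^ (1 / 3 : ℝ) := by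
    change ∫⁻ p, U p ^ (4 / 3 : ℝ) ∂domMeasure ≤ _
    rw [domMeasure_eq]
    exact (lintegral_prod_le _).trans (lintegral_mono hx)
  refine hmain.trans ?_
  have hgrid := lintegral_mul_prod_lintegral_pow_le (fun _ : Fin 3 => (volume : Measure ℝ))
    (p := 1 / 3) (by norm_num) (by norm_num) hFm
  have hexp : (1 : ℝ) - ((Fintype.card (Fin 3) : ℝ) - 1) * (1 / 3) = 1 / 3 := by norm_num
  have hexp' : (1 : ℝ) + 1 / 3 = 4 / 3 := by norm_num
  rw [hexp, hexp', ← volume_pi, hFint] at hgrid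
  calc ∫⁻ x, H x ^ (1 / 3 : ℝ) * ∏ i, (∫⁻ t : ℝ, K (Function.update x i t)) ^ (1 / 3 : ℝ)
      ≤ ∫⁻ x, c⁻¹ ^ (1 / 3 : ℝ) * (F x ^ (1 / 3 : ℝ) *
          ∏ i, (∫⁻ t : ℝ, F (Function.update x i t)) ^ (1 / 3 : ℝ)) := by
        refine lintegral_mono fun x => ?_
        rw [← mul_assoc]
        refine mul_le_mul' ?_ (Finset.prod_le_prod' fun i _ => ?_)
        · rw [← ENNReal.mul_rpow_of_nonneg _ _ (by norm_num)]
          refine ENNReal.rpow_le_rpow ?_ (by norm_num)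
          calc H x = c⁻¹ * (c * H x) := by
                rw [← mul_assoc, ENNReal.inv_mul_cancel hc0 hct, one_mul]
            _ ≤ c⁻¹ * F x := by gcongr; exact le_self_add
        · exact ENNReal.rpow_le_rpow (lintegral_mono fun t => le_add_self) (by norm_num)
    _ = c⁻¹ ^ (1 / 3 : ℝ) * ∫⁻ x, (F x ^ (1 / 3 : ℝ) *
          ∏ i, (∫⁻ t : ℝ, F (Function.update x i t)) ^ (1 / 3 : ℝ)) :=
        lintegral_const_mul' _ _ (ENNReal.rpow_ne_top_of_nonneg (by norm_num)
          (ENNReal.inv_ne_top.2 hc0))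
    _ ≤ _ := by gcongr

lemma gradSqX_nonneg (u : Pt → ℝ) (p : Pt) : 0 ≤ gradSqX u p :=
  Finset.sum_nonneg fun _ _ => sq_nonneg _

lemma measurable_gradx (u : Pt → ℝ) (i : Fin 3) : Measurable fun p => gradx u p i :=
  measurable_fderiv_apply_const ℝ u (ex i)

lemma measurable_grady (u : Pt → ℝ) : Measurable (grady u) :=
  measurable_fderiv_apply_const ℝ u ey

lemma measurable_gradSqX (u : Pt → ℝ) : Measurable (gradSqX u) :=
  Finset.measurable_sum _ fun i _ => (measurable_gradx u i).pow_const 2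

namespace H1

variable {u v : Pt → ℝ}

lemma measurable (hu : H1 u) : Measurable u := hu.diff.continuous.measurable

lemma integrable_gradx_sq (hu : H1 u) (i : Fin 3) :
    IntegrableOn (fun p => gradx u p i ^ 2) Dom := by
  refine Integrable.mono' hu.memGrad ((measurable_gradx u i).pow_const 2).aestronglyMeasurable
    (Eventually.of_forall fun p => ?_)
  rw [Real.norm_of_nonneg (sq_nonneg _)]
  have h := Finset.single_le_sum (f := fun i => gradx u p i ^ 2) (fun _ _ => sq_nonneg _)
    (Finset.mem_univ i)
  unfold gradSq gradSqX
  nlinarith [sq_nonneg (grady u p)]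

lemma integrable_gradSqX (hu : H1 u) : IntegrableOn (gradSqX u) Dom :=
  integrable_finsetSum _ fun i _ => hu.integrable_gradx_sq i

lemma integrable_grady_sq (hu : H1 u) : IntegrableOn (fun p => grady u p ^ 2) Dom := by
  refine Integrable.mono' hu.memGrad ((measurable_grady u).pow_const 2).aestronglyMeasurable
    (Eventually.of_forall fun p => ?_)
  rw [Real.norm_of_nonneg (sq_nonneg _)]
  unfold gradSq
  linarith [gradSqX_nonneg u p]

end H1

lemma ex_eq (i : Fin 3) : ex i = (Pi.single i 1, 0) := by
  unfold ex
  congr 1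
  ext j
  simp [Pi.single_apply]

lemma hasDerivAt_comp_update {u : Pt → ℝ} (hu : Differentiable ℝ u) (x : Fin 3 → ℝ) (y : ℝ)
    (i : Fin 3) (t : ℝ) :
    HasDerivAt (fun t => u (Function.update x i t, y))
      (gradx u (Function.update x i t, y) i) t := by
  have h := (hu (Function.update x i t, y)).hasFDerivAt.comp_hasDerivAt t
    ((hasDerivAt_update x i t).prodMk (hasDerivAt_const t y))
  rw [gradx, ex_eq]
  exact h

lemma hasDerivAt_comp_snd {u : Pt → ℝ} (hu : Differentiable ℝ u) (x : Fin 3 → ℝ) (y : ℝ) :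
    HasDerivAt (fun y => u (x, y)) (grady u (x, y)) y :=
  (hu (x, y)).hasFDerivAt.comp_hasDerivAt y ((hasDerivAt_const y x).prodMk (hasDerivAt_id y))

lemma integrable_sq_mul_and_integral_le {μ : Measure Pt} {f s : Pt → ℝ} (hf : Measurable f)
    (hs : Measurable s) (hs0 : ∀ p, 0 ≤ s p) (hf4 : Integrable (fun p => f p ^ 4) μ)
    (hs2 : Integrable (fun p => s p ^ 2) μ) {n σ : ℝ} (hn : 0 < n) (hσ : 0 < σ)
    (hfn : ∫ p, f p ^ 4 ∂μ = n ^ 2) (hsσ : ∫ p, s p ^ 2 ∂μ ≤ σ ^ 2) :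
    Integrable (fun p => f p ^ 2 * s p) μ ∧ ∫ p, f p ^ 2 * s p ∂μ ≤ n * σ := by
  have hpt : ∀ p, f p ^ 2 * s p ≤ σ / (2 * n) * f p ^ 4 + n / (2 * σ) * s p ^ 2 := by
    intro p
    have h : σ / (2 * n) * f p ^ 4 + n / (2 * σ) * s p ^ 2 - f p ^ 2 * s p
        = (σ * f p ^ 2 - n * s p) ^ 2 / (2 * n * σ) := by
      field_simp
      ring
    have : 0 ≤ (σ * f p ^ 2 - n * s p) ^ 2 / (2 * n * σ) := by positivity
    linarith
  have hi : Integrable (fun p => σ / (2 * n) * f p ^ 4 + n / (2 * σ) * s p ^ 2) μ :=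
    (hf4.const_mul _).add (hs2.const_mul _)
  have hInt : Integrable (fun p => f p ^ 2 * s p) μ := by
    refine hi.mono' ((hf.pow_const 2).mul hs).aestronglyMeasurable
      (Eventually.of_forall fun p => ?_)
    rw [Real.norm_of_nonneg (mul_nonneg (sq_nonneg _) (hs0 p))]
    exact hpt p
  refine ⟨hInt, (integral_mono hInt hi hpt).trans ?_⟩
  rw [integral_add (hf4.const_mul _) (hs2.const_mul _), integral_const_mul, integral_const_mul,
    hfn]
  calc σ / (2 * n) * n ^ 2 + n / (2 * σ) * ∫ p, s p ^ 2 ∂μ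
      ≤ σ / (2 * n) * n ^ 2 + n / (2 * σ) * σ ^ 2 := by gcongr
    _ = n * σ := by field_simp; ring

/-- The anisotropic Gagliardo–Nirenberg inequality
`‖u‖₄⁴ ≤ C ‖∇ₓu‖₂³ max(‖u‖₂, ‖u_y‖₂)` on the waveguide. -/
lemma H1.integral_pow_four_le {u : Pt → ℝ} (hu : H1 u) {a b : ℝ} (ha : 0 < a) (hb : 0 < b)
    (hx : ∫ p in Dom, gradSqX u p ≤ a ^ 2) (hy : ∫ p in Dom, grady u p ^ 2 ≤ b ^ 2)
    (h2 : ∫ p in Dom, u p ^ 2 ≤ b ^ 2) :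
    ∫ p in Dom, u p ^ 4 ≤ 4096 * a ^ 3 * b := by
  have hP0 : 0 ≤ ∫ p in Dom, u p ^ 4 := integral_nonneg fun p => by positivity
  rcases hP0.eq_or_lt with hP | hP
  · rw [← hP]; positivity
  obtain ⟨n, hn, hPn⟩ : ∃ n : ℝ, 0 < n ∧ ∫ p in Dom, u p ^ 4 = n ^ 2 :=
    ⟨_, Real.sqrt_pos.2 hP, (Real.sq_sqrt hP0).symm⟩
  have hum := hu.measurable
  set gx : Pt → ℝ := fun p => Real.sqrt (gradSqX u p) with hgx
  have hgx2 : (fun p => gx p ^ 2) = gradSqX u :=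
    funext fun p => Real.sq_sqrt (gradSqX_nonneg u p)
  obtain ⟨iu, bu⟩ := integrable_sq_mul_and_integral_le hum (continuous_abs.measurable.comp hum)
    (fun p => abs_nonneg (u p)) hu.memL4 (by simpa [sq_abs, IntegrableOn] using hu.memL2) hn hb hPn
    (by simpa [sq_abs] using h2)
  obtain ⟨ix, bx⟩ := integrable_sq_mul_and_integral_le hum (s := gx)
    (measurable_gradSqX u).sqrt (fun p => Real.sqrt_nonneg _) hu.memL4
    (by rw [hgx2]; exact hu.integrable_gradSqX) hn ha hPn (by rw [hgx2]; exact hx)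
  obtain ⟨iy, bY⟩ := integrable_sq_mul_and_integral_le hum
    (continuous_abs.measurable.comp (measurable_grady u))
    (fun p => abs_nonneg (grady u p)) hu.memL4
    (by simpa [sq_abs, IntegrableOn] using hu.integrable_grady_sq) hn hb hPn (by simpa [sq_abs] using hy)
  simp only [Function.comp_apply] at iu bu iy bY
  have hR : 0 < b / a := div_pos hb ha
  have hpi : (0 : ℝ) < 2 * π := by positivity
  have key : ∀ (L σ : ℝ) (s : Pt → ℝ), 0 < L → Measurable s → (∀ p, 0 ≤ s p) →
      Integrable (fun p => u p ^ 2 * s p) (volume.restrict Dom) →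
      ∫ p in Dom, u p ^ 2 * s p ≤ n * σ →
      Measurable (fun p => ENNReal.ofReal (|u p| ^ 3 / L + 3 * u p ^ 2 * s p)) ∧
      ∫⁻ p in Dom, ENNReal.ofReal (|u p| ^ 3 / L + 3 * u p ^ 2 * s p) ≤
        ENNReal.ofReal (n * b / L + 3 * (n * σ)) := by
    intro L σ s hL hsm hs0 is bs
    have e : (fun p => |u p| ^ 3 / L + 3 * u p ^ 2 * s p)
        = fun p => (u p ^ 2 * |u p|) * L⁻¹ + 3 * (u p ^ 2 * s p) := by
      funext p
      rw [← sq_abs (u p)]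
      ring
    refine ⟨?_, ?_⟩
    · exact ((((continuous_abs.measurable.comp hum).pow_const 3).div_const L).add
        (((hum.pow_const 2).const_mul 3).mul hsm)).ennreal_ofReal
    · rw [← ofReal_integral_eq_lintegral_ofReal]
      · refine ENNReal.ofReal_le_ofReal ?_
        rw [e, integral_add (iu.mul_const _) (is.const_mul _), integral_mul_const,
          integral_const_mul, div_eq_mul_inv]
        gcongr
      · rw [e]
        exact (iu.mul_const _).add (is.const_mul _)
      · exact Eventually.of_forall fun p => by
          have := hs0 p
          positivity
  obtain ⟨m₁, l₁⟩ := key (b / a) a gx hR (measurable_gradSqX u).sqrt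
    (fun p => Real.sqrt_nonneg _) ix bx
  obtain ⟨m₂, l₂⟩ := key (2 * π) b (fun p => |grady u p|) hpi
    (continuous_abs.measurable.comp (measurable_grady u)) (fun p => abs_nonneg _) iy bY
  have line₁ : ∀ x y i, ENNReal.ofReal (|u (x, y)| ^ 3) ≤
      ∫⁻ t : ℝ, ENNReal.ofReal (|u (Function.update x i t, y)| ^ 3 / (b / a) +
        3 * u (Function.update x i t, y) ^ 2 * gx (Function.update x i t, y)) := by
    intro x y i
    have hd : ∀ t, HasDerivAt (fun t => u (Function.update x i t, y))
      (gradx u (Function.update x i t, y) i) t := hasDerivAt_comp_update hu.diff x y i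
    have h := ofReal_abs_cube_le_lintegral (φ := fun t => u (Function.update x i t, y))
      (fun t => (hd t).differentiableAt) (a := x i) (b := x i + b / a) (s := x i)
      (by linarith) ⟨le_rfl, by linarith⟩
    simp only [Function.update_eq_self, add_sub_cancel_left] at h
    refine h.trans ((setLIntegral_le_lintegral _ _).trans (lintegral_mono fun t => ?_))
    rw [(hd t).deriv]
    refine ENNReal.ofReal_le_ofReal ?_
    gcongr
    refine Real.abs_le_sqrt ?_
    exact Finset.single_le_sum (f := fun j => gradx u (Function.update x i t, y) j ^ 2)
      (fun _ _ => sq_nonneg _) (Finset.mem_univ i)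
  have line₂ : ∀ x, ∀ y ∈ Set.Ioc 0 (2 * π), ENNReal.ofReal (|u (x, y)| ^ 3) ≤
      ∫⁻ s in Set.Ioc 0 (2 * π), ENNReal.ofReal (|u (x, s)| ^ 3 / (2 * π) +
        3 * u (x, s) ^ 2 * |grady u (x, s)|) := by
    intro x y hy
    have hd : ∀ t, HasDerivAt (fun t => u (x, t)) (grady u (x, t)) t :=
      hasDerivAt_comp_snd hu.diff x
    have h := ofReal_abs_cube_le_lintegral (φ := fun t => u (x, t))
      (fun t => (hd t).differentiableAt) hpi (Set.Ioc_subset_Icc_self hy)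
    simp only [sub_zero, (hd _).deriv] at h
    exact h
  have hc : 0 < a / b := div_pos ha hb
  have main := lintegral_rpow_le_of_line_bounds (U := fun p => ENNReal.ofReal (|u p| ^ 3))
    m₁ m₂ line₁ line₂ (c := ENNReal.ofReal (a / b)) (ENNReal.ofReal_pos.2 hc).ne'
    ENNReal.ofReal_ne_top
  have hlhs : ∫⁻ p in Dom, ENNReal.ofReal (|u p| ^ 3) ^ (4 / 3 : ℝ) = ENNReal.ofReal (n ^ 2) := by
    rw [← hPn, ofReal_integral_eq_lintegral_ofReal hu.memL4
      (Eventually.of_forall fun p => by positivity)]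
    refine lintegral_congr fun p => ?_
    rw [ENNReal.ofReal_rpow_of_nonneg (by positivity) (by norm_num), ← Real.rpow_natCast,
      ← Real.rpow_mul (abs_nonneg _)]
    rw [show ((3 : ℕ) : ℝ) * (4 / 3) = ((4 : ℕ) : ℝ) by norm_num, Real.rpow_natCast, ← abs_pow,
      abs_of_nonneg (by positivity)]
  have hsum : ENNReal.ofReal (a / b) *
      (∫⁻ p in Dom, ENNReal.ofReal (|u p| ^ 3 / (2 * π) + 3 * u p ^ 2 * |grady u p|)) +
      ∫⁻ p in Dom, ENNReal.ofReal (|u p| ^ 3 / (b / a) + 3 * u p ^ 2 * gx p) ≤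
      ENNReal.ofReal (8 * n * a) := by
    refine (add_le_add (mul_le_mul_right l₂ _) l₁).trans ?_
    rw [← ENNReal.ofReal_mul hc.le, ← ENNReal.ofReal_add (by positivity) (by positivity)]
    refine ENNReal.ofReal_le_ofReal ?_
    have h1 : n * b / (2 * π) ≤ n * b := by
      refine div_le_self (by positivity) ?_
      nlinarith [Real.pi_gt_three]
    calc a / b * (n * b / (2 * π) + 3 * (n * b)) + (n * b / (b / a) + 3 * (n * a))
        ≤ a / b * (n * b + 3 * (n * b)) + (n * b / (b / a) + 3 * (n * a)) := by gcongr
      _ = 8 * n * a := by field_simp; ring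
  rw [hlhs] at main
  have main' := main.trans (mul_le_mul_right (ENNReal.rpow_le_rpow hsum (by norm_num)) _)
  rw [← ENNReal.ofReal_inv_of_pos hc, ENNReal.ofReal_rpow_of_pos (by positivity),
    ENNReal.ofReal_rpow_of_pos (by positivity), ← ENNReal.ofReal_mul (by positivity),
    ENNReal.ofReal_le_ofReal_iff (by positivity)] at main'
  have hcube := pow_le_pow_left₀ (by positivity) main' 3
  rw [mul_pow, ← Real.rpow_natCast, ← Real.rpow_natCast (_ ^ (4 / 3 : ℝ)),
    ← Real.rpow_natCast (_ ^ (1 / 3 : ℝ)), ← Real.rpow_mul (by positivity),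
    ← Real.rpow_mul (by positivity)] at hcube
  norm_num at hcube
  rw [hPn]
  have hn4 : 0 < n ^ 4 := by positivity
  refine le_of_mul_le_mul_left ?_ hn4
  calc n ^ 4 * n ^ 2 = (n ^ 2) ^ 3 := by ring
    _ ≤ b / a * (8 * n * a) ^ 4 := hcube
    _ = n ^ 4 * (4096 * a ^ 3 * b) := by field_simp; ring

/-! ### Continuity of the functionals along paths -/

lemma gradx_sub {u v : Pt → ℝ} (hu : Differentiable ℝ u) (hv : Differentiable ℝ v) (p : Pt)
    (i : Fin 3) : gradx (fun q => u q - v q) p i = gradx u p i - gradx v p i := by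
  simp only [gradx, fderiv_fun_sub (hu p) (hv p)]
  rfl

lemma grady_sub {u v : Pt → ℝ} (hu : Differentiable ℝ u) (hv : Differentiable ℝ v) (p : Pt) :
    grady (fun q => u q - v q) p = grady u p - grady v p := by
  simp only [grady, fderiv_fun_sub (hu p) (hv p)]
  rfl

lemma nonlin_eq_sq (u v : Pt → ℝ) (p : Pt) : nonlin u v p = (u p ^ 2 + v p ^ 2) ^ 2 := by
  unfold nonlin
  ring

namespace H1

variable {u v : Pt → ℝ}

lemma sub (hu : H1 u) (hv : H1 v) : H1 (fun q => u q - v q) where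
  periodic x y := by simp only [hu.periodic x y, hv.periodic x y]
  diff := hu.diff.sub hv.diff
  memL2 := by
    refine Integrable.mono' ((hu.memL2.add hv.memL2).const_mul 2)
      ((hu.measurable.sub hv.measurable).pow_const 2).aestronglyMeasurable
      (Eventually.of_forall fun p => ?_)
    rw [Real.norm_of_nonneg (by positivity)]
    simp only [Pi.add_apply]
    nlinarith [sq_nonneg (u p + v p)]
  memGrad := by
    refine Integrable.mono' ((hu.memGrad.add hv.memGrad).const_mul 2)
      ((measurable_gradSqX _).add ((measurable_grady _).pow_const 2)).aestronglyMeasurable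
      (Eventually.of_forall fun p => ?_)
    rw [Real.norm_of_nonneg (show 0 ≤ gradSq _ p from
      add_nonneg (gradSqX_nonneg _ _) (sq_nonneg _))]
    simp only [Pi.add_apply, gradSq, gradSqX, gradx_sub hu.diff hv.diff,
      grady_sub hu.diff hv.diff, Fin.sum_univ_three]
    nlinarith [sq_nonneg (gradx u p 0 + gradx v p 0), sq_nonneg (gradx u p 1 + gradx v p 1),
      sq_nonneg (gradx u p 2 + gradx v p 2), sq_nonneg (grady u p + grady v p)]
  memL4 := by
    refine Integrable.mono' ((hu.memL4.add hv.memL4).const_mul 8)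
      ((hu.measurable.sub hv.measurable).pow_const 4).aestronglyMeasurable
      (Eventually.of_forall fun p => ?_)
    rw [Real.norm_of_nonneg (by positivity)]
    simp only [Pi.add_apply]
    have h1 : (u p - v p) ^ 2 ≤ 2 * (u p ^ 2 + v p ^ 2) := by nlinarith [sq_nonneg (u p + v p)]
    calc (u p - v p) ^ 4 = ((u p - v p) ^ 2) ^ 2 := by ring
      _ ≤ (2 * (u p ^ 2 + v p ^ 2)) ^ 2 := pow_le_pow_left₀ (sq_nonneg _) h1 2
      _ ≤ 8 * (u p ^ 4 + v p ^ 4) := by nlinarith [sq_nonneg (u p ^ 2 - v p ^ 2)]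

lemma integrable_nonlin (hu : H1 u) (hv : H1 v) : IntegrableOn (nonlin u v) Dom := by
  refine Integrable.mono' ((hu.memL4.add hv.memL4).const_mul 2) ?_
    (Eventually.of_forall fun p => ?_)
  · simp_rw [funext (nonlin_eq_sq u v)]
    exact (((hu.measurable.pow_const 2).add
      (hv.measurable.pow_const 2)).pow_const 2).aestronglyMeasurable
  · rw [nonlin_eq_sq, Real.norm_of_nonneg (by positivity)]
    simp only [Pi.add_apply]
    nlinarith [sq_nonneg (u p ^ 2 - v p ^ 2)]

lemma integral_nonlin_le (hu : H1 u) (hv : H1 v) :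
    ∫ p in Dom, nonlin u v p ≤ 2 * ((∫ p in Dom, u p ^ 4) + ∫ p in Dom, v p ^ 4) := by
  rw [← integral_add hu.memL4 hv.memL4, ← integral_const_mul]
  refine integral_mono (hu.integrable_nonlin hv) ((hu.memL4.add hv.memL4).const_mul 2)
    fun p => ?_
  simp only [nonlin_eq_sq]
  nlinarith [sq_nonneg (u p ^ 2 - v p ^ 2)]

lemma energy_eq (hu : H1 u) (hv : H1 v) :
    energy u v = (1 / 2) * ((∫ p in Dom, gradSqX u p) + ∫ p in Dom, gradSqX v p) +
      (1 / 2) * ((∫ p in Dom, grady u p ^ 2) + ∫ p in Dom, grady v p ^ 2) -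
      (1 / 4) * ∫ p in Dom, nonlin u v p := by
  have h : ∀ {w : Pt → ℝ}, H1 w → ∫ p in Dom, gradSq w p =
      (∫ p in Dom, gradSqX w p) + ∫ p in Dom, grady w p ^ 2 := fun hw =>
    integral_add hw.integrable_gradSqX hw.integrable_grady_sq
  rw [energy, integral_add hu.memGrad hv.memGrad, h hu, h hv]
  ring

lemma svirial_eq (hu : H1 u) (hv : H1 v) :
    svirial u v = ((∫ p in Dom, gradSqX u p) + ∫ p in Dom, gradSqX v p) -
      (3 / 4) * ∫ p in Dom, nonlin u v p := by
  rw [svirial, integral_add hu.integrable_gradSqX hv.integrable_gradSqX]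

lemma integrals_le_of_h1dist_lt (hu : H1 u) (hv : H1 v) {r : ℝ} (h : h1dist u v < r) :
    (∫ p in Dom, gradSqX (fun q => u q - v q) p) ≤ r ^ 2 ∧
    (∫ p in Dom, grady (fun q => u q - v q) p ^ 2) ≤ r ^ 2 ∧
    (∫ p in Dom, (u p - v p) ^ 2) ≤ r ^ 2 := by
  have hw := hu.sub hv
  have hr : 0 ≤ r := (Real.sqrt_nonneg _).trans h.le
  have e : ∫ p in Dom, ((u p - v p) ^ 2 + gradSq (fun q => u q - v q) p) =
      (∫ p in Dom, (u p - v p) ^ 2) + ((∫ p in Dom, gradSqX (fun q => u q - v q) p) +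
        ∫ p in Dom, grady (fun q => u q - v q) p ^ 2) := by
    rw [integral_add hw.memL2 hw.memGrad]
    congr 1
    exact integral_add hw.integrable_gradSqX hw.integrable_grady_sq
  have h' : ∫ p in Dom, ((u p - v p) ^ 2 + gradSq (fun q => u q - v q) p) ≤ r ^ 2 :=
    (Real.sqrt_le_left hr).1 h.le
  rw [e] at h'
  have h1 : 0 ≤ ∫ p in Dom, (u p - v p) ^ 2 := integral_nonneg fun _ => sq_nonneg _
  have h2 : 0 ≤ ∫ p in Dom, gradSqX (fun q => u q - v q) p :=
    integral_nonneg fun _ => gradSqX_nonneg _ _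
  have h3 : 0 ≤ ∫ p in Dom, grady (fun q => u q - v q) p ^ 2 :=
    integral_nonneg fun _ => sq_nonneg _
  exact ⟨by linarith, by linarith, by linarith⟩

end H1

lemma abs_sq_sub_sq_le {c : ℝ} (hc : 0 < c) (a b : ℝ) :
    |a ^ 2 - b ^ 2| ≤ c * b ^ 2 + (1 + 1 / c) * (a - b) ^ 2 := by
  have e : c * b ^ 2 + (a - b) ^ 2 / c - 2 * (|a - b| * |b|) = (c * |b| - |a - b|) ^ 2 / c := by
    rw [← sq_abs b, ← sq_abs (a - b)]
    field_simp
    ring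
  have h0 : 0 ≤ (c * |b| - |a - b|) ^ 2 / c := by positivity
  calc |a ^ 2 - b ^ 2| = |(a - b) ^ 2 + 2 * ((a - b) * b)| := by congr 1; ring
    _ ≤ |(a - b) ^ 2| + |2 * ((a - b) * b)| := abs_add_le _ _
    _ = (a - b) ^ 2 + 2 * (|a - b| * |b|) := by
      rw [abs_of_nonneg (sq_nonneg _), abs_mul, abs_mul, abs_two]
    _ ≤ c * b ^ 2 + (1 + 1 / c) * (a - b) ^ 2 := by
      rw [add_mul, one_mul, one_div_mul_eq_div]
      linarith

lemma exists_abs_sq_add_sq_sq_sub_le {c : ℝ} (hc : 0 < c) : ∃ C : ℝ, 0 ≤ C ∧ ∀ a b a' b' : ℝ,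
    |(a ^ 2 + b ^ 2) ^ 2 - (a' ^ 2 + b' ^ 2) ^ 2| ≤
      c * (a' ^ 2 + b' ^ 2) ^ 2 + C * ((a - a') ^ 2 + (b - b') ^ 2) ^ 2 := by
  obtain ⟨l, hl, hl1, hlc⟩ : ∃ l : ℝ, 0 < l ∧ l ≤ 1 ∧ 5 * l ≤ c :=
    ⟨min 1 (c / 5), by positivity, min_le_left _ _, by linarith [min_le_right 1 (c / 5)]⟩
  set M := 1 + 1 / l with hM
  have hM0 : 0 < M := by positivity
  have hlM : l * M = l + 1 := by rw [hM]; field_simp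
  refine ⟨2 * M ^ 3, by positivity, fun a b a' b' => ?_⟩
  set P := a' ^ 2 + b' ^ 2 with hP
  set Q := a ^ 2 + b ^ 2 with hQ
  set e := (a - a') ^ 2 + (b - b') ^ 2 with he
  have h1 : |Q - P| ≤ l * P + M * e := by
    calc |Q - P| = |(a ^ 2 - a' ^ 2) + (b ^ 2 - b' ^ 2)| := by congr 1; rw [hP, hQ]; ring
      _ ≤ |a ^ 2 - a' ^ 2| + |b ^ 2 - b' ^ 2| := abs_add_le _ _
      _ ≤ (l * a' ^ 2 + M * (a - a') ^ 2) + (l * b' ^ 2 + M * (b - b') ^ 2) :=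
        add_le_add (abs_sq_sub_sq_le hl _ _) (abs_sq_sub_sq_le hl _ _)
      _ = l * P + M * e := by rw [hP, he]; ring
  have h2 : (Q - P) ^ 2 ≤ 2 * (l * P) ^ 2 + 2 * (M * e) ^ 2 := by
    rw [← sq_abs]
    calc |Q - P| ^ 2 ≤ (l * P + M * e) ^ 2 := pow_le_pow_left₀ (abs_nonneg _) h1 2
      _ ≤ _ := by nlinarith [sq_nonneg (l * P - M * e)]
  calc |Q ^ 2 - P ^ 2| ≤ l * P ^ 2 + M * (Q - P) ^ 2 := abs_sq_sub_sq_le hl _ _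
    _ ≤ l * P ^ 2 + M * (2 * (l * P) ^ 2 + 2 * (M * e) ^ 2) := by gcongr
    _ = (l + 2 * l * (l * M)) * P ^ 2 + 2 * M ^ 3 * e ^ 2 := by ring
    _ ≤ c * P ^ 2 + 2 * M ^ 3 * e ^ 2 := by
      gcongr
      rw [hlM]
      nlinarith

lemma continuousOn_of_abs_sub_le {S : Set ℝ} {F : ℝ → ℝ} {D : ℝ → ℝ → ℝ}
    (hD : ∀ t ∈ S, ∀ η > 0, ∃ δ > 0, ∀ s ∈ S, |s - t| < δ → D s t < η)
    (hF : ∀ c > 0, ∃ C, 0 ≤ C ∧ ∀ s ∈ S, ∀ t ∈ S, |F s - F t| ≤ c * F t + C * D s t) :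
    ContinuousOn F S := by
  rw [Metric.continuousOn_iff]
  intro t ht ε hε
  obtain ⟨C, hC, h⟩ := hF (ε / (2 * (|F t| + 1))) (by positivity)
  obtain ⟨δ, hδ, hd⟩ := hD t ht (ε / (2 * (C + 1))) (by positivity)
  refine ⟨δ, hδ, fun s hs hst => ?_⟩
  rw [Real.dist_eq] at hst ⊢
  have h1 : ε / (2 * (|F t| + 1)) * F t ≤ ε / 2 := by
    calc ε / (2 * (|F t| + 1)) * F t ≤ ε / (2 * (|F t| + 1)) * (|F t| + 1) := by
          gcongr
          linarith [le_abs_self (F t)]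
      _ = ε / 2 := by field_simp
  have h2 : C * D s t < ε / 2 := by
    rcases hC.eq_or_lt with h0 | h0
    · rw [← h0, zero_mul]; positivity
    · calc C * D s t < C * (ε / (2 * (C + 1))) := by
            gcongr
            exact hd s hs hst
        _ ≤ (C + 1) * (ε / (2 * (C + 1))) := by gcongr; linarith
        _ = ε / 2 := by field_simp
  linarith [h s hs t ht]

lemma abs_integral_sub_le {μ : Measure Pt} {f g e : Pt → ℝ} (hf : Integrable f μ)
    (hg : Integrable g μ) (he : Integrable e μ) {c C : ℝ}
    (h : ∀ p, |f p - g p| ≤ c * g p + C * e p) :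
    |(∫ p, f p ∂μ) - ∫ p, g p ∂μ| ≤ c * (∫ p, g p ∂μ) + C * ∫ p, e p ∂μ := by
  rw [← integral_sub hf hg, ← integral_const_mul, ← integral_const_mul,
    ← integral_add (hg.const_mul _) (he.const_mul _)]
  exact abs_integral_le_integral_abs.trans (integral_mono (hf.sub hg).abs
    ((hg.const_mul _).add (he.const_mul _)) h)

section Path

variable {g : ℝ → (Pt → ℝ) × (Pt → ℝ)}

lemma continuousOn_integral_gradSqX {w : ℝ → Pt → ℝ} {S : Set ℝ} (hw : ∀ t ∈ S, H1 (w t))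
    (hc : ∀ t ∈ S, ∀ ε > 0, ∃ δ > 0, ∀ s ∈ S, |s - t| < δ → h1dist (w s) (w t) < ε) :
    ContinuousOn (fun t => ∫ p in Dom, gradSqX (w t) p) S ∧
    ContinuousOn (fun t => ∫ p in Dom, grady (w t) p ^ 2) S := by
  have hD : ∀ η : ℝ, 0 < η → Real.sqrt (η / 2) ^ 2 < η := by
    intro η hη
    rw [Real.sq_sqrt (by positivity)]
    linarith
  constructor
  · refine continuousOn_of_abs_sub_le
      (D := fun s t => ∫ p in Dom, gradSqX (fun q => w s q - w t q) p) ?_ ?_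
    · intro t ht η hη
      obtain ⟨δ, hδ, h⟩ := hc t ht (Real.sqrt (η / 2)) (Real.sqrt_pos.2 (by positivity))
      exact ⟨δ, hδ, fun s hs hst => lt_of_le_of_lt
        ((hw s hs).integrals_le_of_h1dist_lt (hw t ht) (h s hs hst)).1 (hD η hη)⟩
    · intro c hc'
      refine ⟨1 + 1 / c, by positivity, fun s hs t ht => ?_⟩
      refine abs_integral_sub_le (hw s hs).integrable_gradSqX (hw t ht).integrable_gradSqX
        ((hw s hs).sub (hw t ht)).integrable_gradSqX fun p => ?_
      simp only [gradSqX, gradx_sub (hw s hs).diff (hw t ht).diff]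
      rw [← Finset.sum_sub_distrib, Finset.mul_sum, Finset.mul_sum, ← Finset.sum_add_distrib]
      exact (Finset.abs_sum_le_sum_abs _ _).trans
        (Finset.sum_le_sum fun i _ => abs_sq_sub_sq_le hc' _ _)
  · refine continuousOn_of_abs_sub_le
      (D := fun s t => ∫ p in Dom, grady (fun q => w s q - w t q) p ^ 2) ?_ ?_
    · intro t ht η hη
      obtain ⟨δ, hδ, h⟩ := hc t ht (Real.sqrt (η / 2)) (Real.sqrt_pos.2 (by positivity))
      exact ⟨δ, hδ, fun s hs hst => lt_of_le_of_lt
        ((hw s hs).integrals_le_of_h1dist_lt (hw t ht) (h s hs hst)).2.1 (hD η hη)⟩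
    · intro c hc'
      refine ⟨1 + 1 / c, by positivity, fun s hs t ht => ?_⟩
      refine abs_integral_sub_le (hw s hs).integrable_grady_sq (hw t ht).integrable_grady_sq
        ((hw s hs).sub (hw t ht)).integrable_grady_sq fun p => ?_
      rw [grady_sub (hw s hs).diff (hw t ht).diff]
      exact abs_sq_sub_sq_le hc' _ _

lemma PathCont.continuousOn_nonlin (hg : PathCont g)
    (h : ∀ t ∈ Set.Icc (0 : ℝ) 1, H1 (g t).1 ∧ H1 (g t).2) :
    ContinuousOn (fun t => ∫ p in Dom, nonlin (g t).1 (g t).2 p) (Set.Icc 0 1) := by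
  refine continuousOn_of_abs_sub_le (D := fun s t => ∫ p in Dom,
    nonlin (fun q => (g s).1 q - (g t).1 q) (fun q => (g s).2 q - (g t).2 q) p) ?_ ?_
  · intro t ht η hη
    obtain ⟨r, hr, hr1, hrη⟩ : ∃ r : ℝ, 0 < r ∧ r ≤ 1 ∧ 20000 * r ≤ η :=
      ⟨min 1 (η / 20000), by positivity, min_le_left _ _,
        by linarith [min_le_right 1 (η / 20000)]⟩
    obtain ⟨δ, hδ, hd⟩ := hg t ht r hr
    refine ⟨δ, hδ, fun s hs hst => ?_⟩
    have key : ∀ {u v : Pt → ℝ}, H1 u → H1 v → h1dist u v < r →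
        ∫ p in Dom, (u p - v p) ^ 4 ≤ 4096 * r := by
      intro u v hu hv huv
      obtain ⟨i1, i2, i3⟩ := hu.integrals_le_of_h1dist_lt hv huv
      refine ((hu.sub hv).integral_pow_four_le hr hr i1 i2 i3).trans ?_
      have : r ^ 3 ≤ 1 := pow_le_one₀ hr.le hr1
      nlinarith
    have h1 := key (h s hs).1 (h t ht).1 (hd s hs hst).1
    have h2 := key (h s hs).2 (h t ht).2 (hd s hs hst).2
    have h3 := ((h s hs).1.sub (h t ht).1).integral_nonlin_le ((h s hs).2.sub (h t ht).2)
    linarith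
  · intro c hc
    obtain ⟨C, hC, hb⟩ := exists_abs_sq_add_sq_sq_sub_le hc
    refine ⟨C, hC, fun s hs t ht => ?_⟩
    refine abs_integral_sub_le ((h s hs).1.integrable_nonlin (h s hs).2)
      ((h t ht).1.integrable_nonlin (h t ht).2)
      (((h s hs).1.sub (h t ht).1).integrable_nonlin ((h s hs).2.sub (h t ht).2)) fun p => ?_
    simp only [nonlin_eq_sq]
    exact hb _ _ _ _

lemma PathCont.continuousOn_functionals (hg : PathCont g)
    (h : ∀ t ∈ Set.Icc (0 : ℝ) 1, H1 (g t).1 ∧ H1 (g t).2) :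
    ContinuousOn (fun t => energy (g t).1 (g t).2) (Set.Icc 0 1) ∧
    ContinuousOn (fun t => svirial (g t).1 (g t).2) (Set.Icc 0 1) := by
  obtain ⟨x₁, y₁⟩ := continuousOn_integral_gradSqX (w := fun t => (g t).1)
    (fun t ht => (h t ht).1) fun t ht ε hε => by
      obtain ⟨δ, hδ, hd⟩ := hg t ht ε hε
      exact ⟨δ, hδ, fun s hs hst => (hd s hs hst).1⟩
  obtain ⟨x₂, y₂⟩ := continuousOn_integral_gradSqX (w := fun t => (g t).2)
    (fun t ht => (h t ht).2) fun t ht ε hε => by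
      obtain ⟨δ, hδ, hd⟩ := hg t ht ε hε
      exact ⟨δ, hδ, fun s hs hst => (hd s hs hst).2⟩
  have n := hg.continuousOn_nonlin h
  constructor
  · refine ContinuousOn.congr ?_ fun t ht => (h t ht).1.energy_eq (h t ht).2
    exact (((x₁.add x₂).const_mul _).add ((y₁.add y₂).const_mul _)).sub (n.const_mul _)
  · refine ContinuousOn.congr ?_ fun t ht => (h t ht).1.svirial_eq (h t ht).2
    exact (x₁.add x₂).sub (n.const_mul _)

end Path

/-! ### The mass-preserving dilation -/

/-- Dilation of the horizontal variables. -/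
def dil (τ : ℝ) (p : Pt) : Pt := (τ • p.1, p.2)

lemma measurableEmbedding_dil {τ : ℝ} (hτ : 0 < τ) : MeasurableEmbedding (dil τ) :=
  ((Homeomorph.smulOfNeZero τ hτ.ne').prodCongr (Homeomorph.refl ℝ)).measurableEmbedding

lemma continuous_dil : Continuous fun q : ℝ × Pt => dil q.1 q.2 := by
  unfold dil
  fun_prop

lemma map_dil {τ : ℝ} (hτ : 0 < τ) :
    Measure.map (dil τ) domMeasure = ENNReal.ofReal (τ ^ 3)⁻¹ • domMeasure := by
  have hd : dil τ = Prod.map (fun x : Fin 3 → ℝ => τ • x) id := rfl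
  rw [domMeasure_eq, hd, ← Measure.map_prod_map _ _ (measurable_const_smul τ) measurable_id,
    Measure.map_id, Measure.map_addHaar_smul _ hτ.ne', Module.finrank_fin_fun,
    abs_of_pos (by positivity), Measure.prod_smul_left]

lemma integral_dil {τ : ℝ} (hτ : 0 < τ) (f : Pt → ℝ) :
    ∫ p in Dom, f (dil τ p) = (τ ^ 3)⁻¹ * ∫ p in Dom, f p := by
  rw [← (measurableEmbedding_dil hτ).integral_map, map_dil hτ, integral_smul_measure,
    ENNReal.toReal_ofReal (by positivity), smul_eq_mul]

lemma integrableOn_dil {τ : ℝ} (hτ : 0 < τ) {f : Pt → ℝ} (hf : IntegrableOn f Dom) :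
    IntegrableOn (fun p => f (dil τ p)) Dom := by
  refine (measurableEmbedding_dil hτ).integrable_map_iff.1 ?_
  rw [map_dil hτ]
  exact hf.smul_measure ENNReal.ofReal_ne_top

lemma sq_rpow_three_halves {τ : ℝ} (hτ : 0 < τ) : (τ ^ ((3 : ℝ) / 2)) ^ 2 = τ ^ 3 := by
  rw [← Real.rpow_natCast, ← Real.rpow_mul hτ.le]
  norm_num

lemma scaleX_eq (τ : ℝ) (u : Pt → ℝ) :
    scaleX τ u = fun p => τ ^ ((3 : ℝ) / 2) * u (dil τ p) := rfl

lemma hasFDerivAt_scaleX (τ : ℝ) {u : Pt → ℝ} (hu : Differentiable ℝ u) (p : Pt) :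
    HasFDerivAt (scaleX τ u) (τ ^ ((3 : ℝ) / 2) • (fderiv ℝ u (dil τ p)).comp
      ((τ • ContinuousLinearMap.fst ℝ (Fin 3 → ℝ) ℝ).prod
        (ContinuousLinearMap.snd ℝ (Fin 3 → ℝ) ℝ))) p := by
  have h : HasFDerivAt (dil τ) ((τ • ContinuousLinearMap.fst ℝ (Fin 3 → ℝ) ℝ).prod
      (ContinuousLinearMap.snd ℝ (Fin 3 → ℝ) ℝ)) p :=
    ((τ • ContinuousLinearMap.fst ℝ (Fin 3 → ℝ) ℝ).prod
      (ContinuousLinearMap.snd ℝ (Fin 3 → ℝ) ℝ)).hasFDerivAt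
  exact ((hu (dil τ p)).hasFDerivAt.comp p h).const_mul _

lemma gradx_scaleX (τ : ℝ) {u : Pt → ℝ} (hu : Differentiable ℝ u) (p : Pt) (i : Fin 3) :
    gradx (scaleX τ u) p i = τ ^ ((3 : ℝ) / 2) * τ * gradx u (dil τ p) i := by
  have e : ((τ • ContinuousLinearMap.fst ℝ (Fin 3 → ℝ) ℝ).prod
      (ContinuousLinearMap.snd ℝ (Fin 3 → ℝ) ℝ)) (ex i) = τ • ex i := by
    ext <;> simp [ex]
  rw [gradx, (hasFDerivAt_scaleX τ hu p).fderiv, _root_.smul_apply,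
    ContinuousLinearMap.comp_apply, e, map_smul, gradx, smul_eq_mul, smul_eq_mul, mul_assoc]

lemma grady_scaleX (τ : ℝ) {u : Pt → ℝ} (hu : Differentiable ℝ u) (p : Pt) :
    grady (scaleX τ u) p = τ ^ ((3 : ℝ) / 2) * grady u (dil τ p) := by
  have e : ((τ • ContinuousLinearMap.fst ℝ (Fin 3 → ℝ) ℝ).prod
      (ContinuousLinearMap.snd ℝ (Fin 3 → ℝ) ℝ)) ey = ey := by
    ext <;> simp [ey]
  rw [grady, (hasFDerivAt_scaleX τ hu p).fderiv, _root_.smul_apply,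
    ContinuousLinearMap.comp_apply, e, grady, smul_eq_mul]

lemma gradSqX_scaleX {τ : ℝ} (hτ : 0 < τ) {u : Pt → ℝ} (hu : Differentiable ℝ u) (p : Pt) :
    gradSqX (scaleX τ u) p = τ ^ 5 * gradSqX u (dil τ p) := by
  simp only [gradSqX, gradx_scaleX τ hu, mul_pow, sq_rpow_three_halves hτ, Finset.mul_sum]
  refine Finset.sum_congr rfl fun i _ => ?_
  ring

lemma grady_scaleX_sq {τ : ℝ} (hτ : 0 < τ) {u : Pt → ℝ} (hu : Differentiable ℝ u) (p : Pt) :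
    grady (scaleX τ u) p ^ 2 = τ ^ 3 * grady u (dil τ p) ^ 2 := by
  rw [grady_scaleX τ hu, mul_pow, sq_rpow_three_halves hτ]

lemma scaleX_sq {τ : ℝ} (hτ : 0 < τ) (u : Pt → ℝ) (p : Pt) :
    scaleX τ u p ^ 2 = τ ^ 3 * u (dil τ p) ^ 2 := by
  rw [scaleX_eq, mul_pow, sq_rpow_three_halves hτ]

lemma nonlin_scaleX {τ : ℝ} (hτ : 0 < τ) (u v : Pt → ℝ) (p : Pt) :
    nonlin (scaleX τ u) (scaleX τ v) p = τ ^ 6 * nonlin u v (dil τ p) := by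
  rw [nonlin_eq_sq, nonlin_eq_sq, scaleX_sq hτ, scaleX_sq hτ]
  ring

namespace H1

variable {u v : Pt → ℝ} {τ : ℝ}

lemma scaleX (hu : H1 u) (hτ : 0 < τ) : H1 (scaleX τ u) where
  periodic x y := by simp only [Waveguide.scaleX, hu.periodic (τ • x) y]
  diff p := (hasFDerivAt_scaleX τ hu.diff p).differentiableAt
  memL2 := by
    simp_rw [scaleX_sq hτ]
    exact (integrableOn_dil hτ hu.memL2).const_mul _
  memGrad := by
    simp only [gradSq, gradSqX_scaleX hτ hu.diff, grady_scaleX_sq hτ hu.diff]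
    exact ((integrableOn_dil hτ hu.integrable_gradSqX).const_mul _).add
      ((integrableOn_dil hτ hu.integrable_grady_sq).const_mul _)
  memL4 := by
    have e : ∀ p, Waveguide.scaleX τ u p ^ 4 = τ ^ 6 * u (dil τ p) ^ 4 := by
      intro p
      rw [show (4 : ℕ) = 2 * 2 from rfl, pow_mul, scaleX_sq hτ]
      ring
    simp_rw [e]
    exact (integrableOn_dil hτ hu.memL4).const_mul _

lemma integral_gradSqX_scaleX (hu : H1 u) (hτ : 0 < τ) :
    ∫ p in Dom, gradSqX (Waveguide.scaleX τ u) p = τ ^ 2 * ∫ p in Dom, gradSqX u p := by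
  simp_rw [gradSqX_scaleX hτ hu.diff]
  rw [integral_const_mul, integral_dil hτ]
  field_simp

lemma integral_grady_scaleX (hu : H1 u) (hτ : 0 < τ) :
    ∫ p in Dom, grady (Waveguide.scaleX τ u) p ^ 2 = ∫ p in Dom, grady u p ^ 2 := by
  simp_rw [grady_scaleX_sq hτ hu.diff]
  rw [integral_const_mul, integral_dil hτ (fun p => grady u p ^ 2)]
  field_simp

end H1

lemma integral_nonlin_scaleX (u v : Pt → ℝ) {τ : ℝ} (hτ : 0 < τ) :
    ∫ p in Dom, nonlin (scaleX τ u) (scaleX τ v) p = τ ^ 3 * ∫ p in Dom, nonlin u v p := by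
  simp_rw [nonlin_scaleX hτ]
  rw [integral_const_mul, integral_dil hτ]
  field_simp

lemma l2_scaleX (u : Pt → ℝ) {τ : ℝ} (hτ : 0 < τ) : l2 (scaleX τ u) = l2 u := by
  unfold l2
  simp_rw [scaleX_sq hτ]
  rw [integral_const_mul, integral_dil hτ (fun p => u p ^ 2), mul_inv_cancel_left₀ (by positivity)]

lemma inS.scaleX {u : Pt → ℝ} {Θ τ : ℝ} (hu : inS Θ u) (hτ : 0 < τ) : inS Θ (scaleX τ u) :=
  ⟨hu.1.scaleX hτ, (l2_scaleX u hτ).trans hu.2⟩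

lemma energy_scaleX {u v : Pt → ℝ} (hu : H1 u) (hv : H1 v) {τ : ℝ} (hτ : 0 < τ) :
    energy (scaleX τ u) (scaleX τ v) =
      (1 / 2) * τ ^ 2 * ((∫ p in Dom, gradSqX u p) + ∫ p in Dom, gradSqX v p) +
      (1 / 2) * ((∫ p in Dom, grady u p ^ 2) + ∫ p in Dom, grady v p ^ 2) -
      (1 / 4) * τ ^ 3 * ∫ p in Dom, nonlin u v p := by
  rw [(hu.scaleX hτ).energy_eq (hv.scaleX hτ), hu.integral_gradSqX_scaleX hτ,
    hv.integral_gradSqX_scaleX hτ, hu.integral_grady_scaleX hτ, hv.integral_grady_scaleX hτ,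
    integral_nonlin_scaleX u v hτ]
  ring

lemma svirial_scaleX {u v : Pt → ℝ} (hu : H1 u) (hv : H1 v) {τ : ℝ} (hτ : 0 < τ) :
    svirial (scaleX τ u) (scaleX τ v) =
      τ ^ 2 * ((∫ p in Dom, gradSqX u p) + ∫ p in Dom, gradSqX v p) -
      (3 / 4) * τ ^ 3 * ∫ p in Dom, nonlin u v p := by
  rw [(hu.scaleX hτ).svirial_eq (hv.scaleX hτ), hu.integral_gradSqX_scaleX hτ,
    hv.integral_gradSqX_scaleX hτ, integral_nonlin_scaleX u v hτ]
  ring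

lemma integrable_sub_sq {μ : Measure Pt} {a b : Pt → ℝ} (ha : Measurable a) (hb : Measurable b)
    (ia : Integrable (fun p => a p ^ 2) μ) (ib : Integrable (fun p => b p ^ 2) μ) :
    Integrable (fun p => (a p - b p) ^ 2) μ :=
  (memLp_two_iff_integrable_sq (ha.sub hb).aestronglyMeasurable).1
    (((memLp_two_iff_integrable_sq ha.aestronglyMeasurable).2 ia).sub
      ((memLp_two_iff_integrable_sq hb.aestronglyMeasurable).2 ib))

lemma tendsto_integral_dil_sub_sq_of_hasCompactSupport {φ : Pt → ℝ} (hφ : Continuous φ)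
    (hs : HasCompactSupport φ) {c : ℝ → ℝ} (hc : ContinuousOn c (Set.Ioi 0)) {t : ℝ}
    (ht : 0 < t) :
    Tendsto (fun s => ∫ p in Dom, (c s * φ (dil s p) - c t * φ (dil t p)) ^ 2)
      (nhds t) (nhds 0) := by
  obtain ⟨r, hr⟩ := hs.isBounded.subset_closedBall 0
  set k : Set Pt := Metric.closedBall 0 (max r (2 * r / t))
  set S := Set.Icc (t / 2) (2 * t)
  have hzero : ∀ s ∈ S, ∀ p : Pt, p ∉ k → φ (dil s p) = 0 := by
    intro s hs' p hp
    by_contra hne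
    apply hp
    have h := hr (subset_tsupport φ hne)
    simp only [dil, mem_closedBall_zero_iff, Prod.norm_def, norm_smul, max_le_iff] at h
    have hs0 : t / 2 ≤ s := hs'.1
    rw [Real.norm_of_nonneg (by linarith)] at h
    simp only [k, mem_closedBall_zero_iff, Prod.norm_def, max_le_iff]
    refine ⟨(le_div_iff₀ ht).2 ?_ |>.trans (le_max_right _ _), h.2.trans (le_max_left _ _)⟩
    have := mul_le_mul_of_nonneg_right hs0 (norm_nonneg p.1)
    nlinarith [h.1]
  have htS : t ∈ S := ⟨by linarith, by linarith⟩
  have hSpos : S ⊆ Set.Ioi 0 := fun s hs' => lt_of_lt_of_le (by positivity) hs'.1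
  have hcont : ContinuousOn
      (fun s => ∫ p in Dom, (c s * φ (dil s p) - c t * φ (dil t p)) ^ 2) S := by
    refine continuousOn_integral_of_compact_support (k := k) (isCompact_closedBall _ _) ?_ ?_
    · have h1 : ContinuousOn (fun q : ℝ × Pt => c q.1) (S ×ˢ Set.univ) :=
        (hc.mono hSpos).comp continuousOn_fst fun q hq => hq.1
      have h2 : Continuous fun q : ℝ × Pt => φ (dil q.1 q.2) := hφ.comp continuous_dil
      have h3 : Continuous fun q : ℝ × Pt => φ (dil t q.2) :=
        hφ.comp (continuous_dil.comp (continuous_const.prodMk continuous_snd))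
      exact ((h1.mul h2.continuousOn).sub (h3.const_mul (c t)).continuousOn).pow 2
    · intro s p hs' hp
      rw [hzero s hs' p hp, hzero t htS p hp]
      ring
  have h := (hcont.continuousAt (Icc_mem_nhds (show t / 2 < t by linarith)
    (show t < 2 * t by linarith))).tendsto
  simpa using h

lemma tendsto_integral_dil_sub_sq {f : Pt → ℝ} (hf : Measurable f)
    (hf2 : IntegrableOn (fun p => f p ^ 2) Dom) {c : ℝ → ℝ} (hc : ContinuousOn c (Set.Ioi 0))
    {t : ℝ} (ht : 0 < t) :
    Tendsto (fun s => ∫ p in Dom, (c s * f (dil s p) - c t * f (dil t p)) ^ 2)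
      (nhds t) (nhds 0) := by
  have hct : ContinuousAt c t := hc.continuousAt (Ioi_mem_nhds ht)
  rw [Metric.tendsto_nhds]
  intro ε hε
  set M := c t ^ 2 * (t ^ 3)⁻¹ + 1 with hM
  have hM0 : 0 < M := by positivity
  have hmem : MemLp f (ENNReal.ofReal 2) (volume.restrict Dom) := by
    rw [ENNReal.ofReal_ofNat]
    exact (memLp_two_iff_integrable_sq hf.aestronglyMeasurable).2 hf2
  obtain ⟨φ, hφs, hφ, hφc, hφm⟩ := hmem.exists_hasCompactSupport_integral_rpow_sub_le
    (by norm_num) (ε := ε / (12 * M)) (by positivity)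
  rw [ENNReal.ofReal_ofNat, memLp_two_iff_integrable_sq hφc.aestronglyMeasurable] at hφm
  simp only [Real.norm_eq_abs, Real.rpow_two, sq_abs] at hφ
  have hbound : ∀ᶠ s in nhds t, c s ^ 2 * (s ^ 3)⁻¹ < M := by
    have h : ContinuousAt (fun s => c s ^ 2 * (s ^ 3)⁻¹) t :=
      (hct.pow 2).mul ((continuousAt_id.pow 3).inv₀ (by simpa using ht.ne'))
    exact h.eventually_lt continuousAt_const (by simp [hM])
  have hφt := (tendsto_integral_dil_sub_sq_of_hasCompactSupport hφc hφs hc ht).eventually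
    (gt_mem_nhds (show (0 : ℝ) < ε / 6 by positivity))
  have hidiff : IntegrableOn (fun p => (f p - φ p) ^ 2) Dom :=
    integrable_sub_sq hf hφc.measurable hf2 hφm
  have hdm : ∀ s, Measurable (dil s) := fun s =>
    (continuous_dil.comp (continuous_const.prodMk continuous_id)).measurable
  have hsq : ∀ {g : Pt → ℝ} {s : ℝ}, 0 < s → IntegrableOn (fun p => g p ^ 2) Dom →
      IntegrableOn (fun p => (c s * g (dil s p)) ^ 2) Dom := by
    intro g s hs hg
    simp_rw [mul_pow]
    exact (integrableOn_dil hs hg).const_mul _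
  have hpiece : ∀ s, 0 < s → c s ^ 2 * (s ^ 3)⁻¹ ≤ M →
      ∫ p in Dom, (c s * (f (dil s p) - φ (dil s p))) ^ 2 ≤ ε / 12 := by
    intro s hs hsM
    simp_rw [mul_pow]
    rw [integral_const_mul, integral_dil hs (fun p => (f p - φ p) ^ 2), ← mul_assoc]
    calc c s ^ 2 * (s ^ 3)⁻¹ * ∫ p in Dom, (f p - φ p) ^ 2 ≤ M * (ε / (12 * M)) := by gcongr
      _ = ε / 12 := by field_simp
  filter_upwards [hbound, hφt, Ioi_mem_nhds ht] with s hs1 hs2 hs3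
  have i1 := hsq (g := fun p => f p - φ p) hs3 hidiff
  have i3 := hsq (g := fun p => f p - φ p) ht hidiff
  have i2 : IntegrableOn (fun p => (c s * φ (dil s p) - c t * φ (dil t p)) ^ 2) Dom :=
    integrable_sub_sq ((hφc.measurable.comp (hdm s)).const_mul _)
      ((hφc.measurable.comp (hdm t)).const_mul _) (hsq hs3 hφm) (hsq ht hφm)
  have i0 : IntegrableOn (fun p => (c s * f (dil s p) - c t * f (dil t p)) ^ 2) Dom :=
    integrable_sub_sq ((hf.comp (hdm s)).const_mul _)
      ((hf.comp (hdm t)).const_mul _) (hsq hs3 hf2) (hsq ht hf2)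
  have i12 : IntegrableOn (fun p => (c s * (f (dil s p) - φ (dil s p))) ^ 2 +
      (c s * φ (dil s p) - c t * φ (dil t p)) ^ 2) Dom := i1.add i2
  have hle : ∫ p in Dom, (c s * f (dil s p) - c t * f (dil t p)) ^ 2 ≤
      ∫ p in Dom, 3 * (((c s * (f (dil s p) - φ (dil s p))) ^ 2 +
        (c s * φ (dil s p) - c t * φ (dil t p)) ^ 2) +
        (c t * (f (dil t p) - φ (dil t p))) ^ 2) := by
    refine integral_mono i0 ((i12.add i3).const_mul 3) fun p => ?_
    set a := c s * (f (dil s p) - φ (dil s p)) with ha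
    set b := c s * φ (dil s p) - c t * φ (dil t p) with hb
    set d := c t * (f (dil t p) - φ (dil t p)) with hd
    have e : c s * f (dil s p) - c t * f (dil t p) = a + b - d := by rw [ha, hb, hd]; ring
    simp only [e]
    nlinarith [sq_nonneg (a - b), sq_nonneg (a + d), sq_nonneg (b + d)]
  rw [integral_const_mul, integral_add i12 i3, integral_add i1 i2] at hle
  rw [Real.dist_eq, sub_zero, abs_of_nonneg (integral_nonneg fun p => sq_nonneg _)]
  have h1 := hpiece s hs3 hs1.le
  have h3 := hpiece t ht (by linarith)
  linarith

lemma H1.tendsto_h1dist_scaleX {u : Pt → ℝ} (hu : H1 u) {t : ℝ} (ht : 0 < t) :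
    Tendsto (fun s => h1dist (Waveguide.scaleX s u) (Waveguide.scaleX t u)) (nhds t) (nhds 0) := by
  have hc : ContinuousOn (fun s : ℝ => s ^ ((3 : ℝ) / 2)) (Set.Ioi 0) :=
    (Real.continuous_rpow_const (by norm_num)).continuousOn
  have hc' : ContinuousOn (fun s : ℝ => s ^ ((3 : ℝ) / 2) * s) (Set.Ioi 0) :=
    hc.mul continuousOn_id
  have h0 := tendsto_integral_dil_sub_sq hu.measurable hu.memL2 hc ht
  have hy := tendsto_integral_dil_sub_sq (measurable_grady u) hu.integrable_grady_sq hc ht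
  have hx := tendsto_finsetSum Finset.univ fun i _ =>
    tendsto_integral_dil_sub_sq (measurable_gradx u i) (hu.integrable_gradx_sq i) hc' ht
  have hsum := (h0.add (hx.add hy)).sqrt
  simp only [Finset.sum_const_zero, add_zero, Real.sqrt_zero] at hsum
  refine hsum.congr' ?_
  filter_upwards [Ioi_mem_nhds ht] with s hs
  have hs' := hu.scaleX hs
  have ht' := hu.scaleX ht
  have hw := hs'.sub ht'
  rw [h1dist, integral_add hw.memL2 hw.memGrad]
  unfold gradSq
  rw [integral_add hw.integrable_gradSqX hw.integrable_grady_sq]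
  unfold gradSqX
  rw [integral_finsetSum _ fun i _ => hw.integrable_gradx_sq i]
  simp only [gradx_sub hs'.diff ht'.diff, grady_sub hs'.diff ht'.diff,
    gradx_scaleX _ hu.diff, grady_scaleX _ hu.diff]
  rfl

/-! ### Functionals on the constraint set -/

/-- `‖∇_x u‖₂² + ‖∇_x v‖₂²`. -/
def horizontal (u v : Pt → ℝ) : ℝ := (∫ p in Dom, gradSqX u p) + ∫ p in Dom, gradSqX v p

/-- `‖u_y‖₂² + ‖v_y‖₂²`. -/
def vertical (u v : Pt → ℝ) : ℝ := (∫ p in Dom, grady u p ^ 2) + ∫ p in Dom, grady v p ^ 2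

/-- `∫ (u⁴ + 2u²v² + v⁴)`. -/
def quartic (u v : Pt → ℝ) : ℝ := ∫ p in Dom, nonlin u v p

lemma vertical_nonneg (u v : Pt → ℝ) : 0 ≤ vertical u v :=
  add_nonneg (integral_nonneg fun _ => sq_nonneg _) (integral_nonneg fun _ => sq_nonneg _)

lemma quartic_nonneg (u v : Pt → ℝ) : 0 ≤ quartic u v :=
  integral_nonneg fun p => by
    simp only [nonlin_eq_sq]
    exact sq_nonneg _

lemma H1.energy_eq_functionals {u v : Pt → ℝ} (hu : H1 u) (hv : H1 v) :
    energy u v = horizontal u v / 2 + vertical u v / 2 - quartic u v / 4 := by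
  rw [hu.energy_eq hv, horizontal, vertical, quartic]
  ring

lemma H1.svirial_eq_functionals {u v : Pt → ℝ} (hu : H1 u) (hv : H1 v) :
    svirial u v = horizontal u v - 3 / 4 * quartic u v :=
  hu.svirial_eq hv

namespace inS

variable {Θ : ℝ} {u v : Pt → ℝ}

lemma integral_sq (hu : inS Θ u) : ∫ p in Dom, u p ^ 2 = Θ ^ 2 := by
  rw [← hu.2, l2, Real.sq_sqrt (integral_nonneg fun p => sq_nonneg _)]

lemma integral_pow_four_pos (hΘ : 0 < Θ) (hu : inS Θ u) : 0 < ∫ p in Dom, u p ^ 4 := by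
  have h0 : 0 ≤ fun p => u p ^ 4 := fun p => by positivity
  refine (integral_nonneg h0).lt_of_ne' fun h => ?_
  have hae := (integral_eq_zero_iff_of_nonneg h0 hu.1.memL4).1 h
  have h2 : ∫ p in Dom, u p ^ 2 = 0 := by
    refine integral_eq_zero_of_ae ?_
    filter_upwards [hae] with p hp
    simpa using hp
  have := hu.integral_sq
  rw [h2] at this
  exact (pow_pos hΘ 2).ne this

lemma integral_gradSqX_pos (hΘ : 0 < Θ) (hu : inS Θ u) : 0 < ∫ p in Dom, gradSqX u p := by
  refine (integral_nonneg (gradSqX_nonneg u)).lt_of_ne' fun h => ?_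
  have hP := hu.integral_pow_four_pos hΘ
  set b := Θ + √(∫ p in Dom, grady u p ^ 2)
  have hy0 : 0 ≤ ∫ p in Dom, grady u p ^ 2 := integral_nonneg fun p => sq_nonneg _
  have hb : 0 < b := by positivity
  have hgn : ∀ a : ℝ, 0 < a → ∫ p in Dom, u p ^ 4 ≤ 4096 * a ^ 3 * b := fun a ha => by
    refine hu.1.integral_pow_four_le ha hb (h.trans_le (sq_nonneg a)) ?_ ?_
    · rw [← Real.sq_sqrt hy0]
      gcongr
      linarith
    · rw [hu.integral_sq]
      gcongr
      linarith [Real.sqrt_nonneg (∫ p in Dom, grady u p ^ 2)]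
  have hlim : Tendsto (fun a : ℝ => 4096 * a ^ 3 * b) (nhdsWithin 0 (Set.Ioi 0)) (nhds 0) := by
    have : Continuous fun a : ℝ => 4096 * a ^ 3 * b := by fun_prop
    simpa using (this.tendsto 0).mono_left nhdsWithin_le_nhds
  exact hP.not_ge (ge_of_tendsto hlim (eventually_mem_nhdsWithin.mono hgn))

lemma horizontal_pos (hΘ : 0 < Θ) (hu : inS Θ u) (hv : inS Θ v) : 0 < horizontal u v :=
  add_pos (hu.integral_gradSqX_pos hΘ) (hv.integral_gradSqX_pos hΘ)

lemma energy_of_svirial_eq_zero (hu : inS Θ u) (hv : inS Θ v) (h : svirial u v = 0) :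
    energy u v = horizontal u v / 6 + vertical u v / 2 := by
  rw [hu.1.svirial_eq_functionals hv.1] at h
  rw [hu.1.energy_eq_functionals hv.1]
  linarith

end inS

lemma exists_pos_le_horizontal {Θ M : ℝ} (hΘ : 0 < Θ) : ∃ κ : ℝ, 0 < κ ∧
    ∀ u v : Pt → ℝ, inS Θ u → inS Θ v → vertical u v ≤ M → svirial u v ≤ 0 →
      κ ≤ horizontal u v := by
  refine ⟨(1 / (12288 * (Θ + √M))) ^ 2, by positivity, fun u v hu hv hY hQ => ?_⟩
  set b := Θ + √M with hbdef
  have hb : 0 < b := by positivity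
  have hX := hu.horizontal_pos hΘ hv
  set a := √(horizontal u v)
  have ha : 0 < a := Real.sqrt_pos.2 hX
  have ha2 : a ^ 2 = horizontal u v := Real.sq_sqrt hX.le
  have hM : 0 ≤ M := (vertical_nonneg u v).trans hY
  have hMb : M ≤ b ^ 2 := by
    rw [← Real.sq_sqrt hM]
    gcongr
    linarith
  have hΘb : Θ ^ 2 ≤ b ^ 2 := by
    gcongr
    linarith [Real.sqrt_nonneg M]
  have x₁ : 0 ≤ ∫ p in Dom, gradSqX u p := integral_nonneg (gradSqX_nonneg u)
  have x₂ : 0 ≤ ∫ p in Dom, gradSqX v p := integral_nonneg (gradSqX_nonneg v)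
  have y₁ : 0 ≤ ∫ p in Dom, grady u p ^ 2 := integral_nonneg fun p => sq_nonneg _
  have y₂ : 0 ≤ ∫ p in Dom, grady v p ^ 2 := integral_nonneg fun p => sq_nonneg _
  have g₁ := hu.1.integral_pow_four_le ha hb (by rw [ha2, horizontal]; linarith)
    (by rw [vertical] at hY; linarith) (hu.integral_sq.trans_le hΘb)
  have g₂ := hv.1.integral_pow_four_le ha hb (by rw [ha2, horizontal]; linarith)
    (by rw [vertical] at hY; linarith) (hv.integral_sq.trans_le hΘb)
  have hN := hu.1.integral_nonlin_le hv.1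
  rw [hu.1.svirial_eq_functionals hv.1, quartic, ← ha2] at hQ
  have hab : a ^ 2 * 1 ≤ a ^ 2 * (12288 * b * a) := by linarith
  have hab' := le_of_mul_le_mul_left hab (by positivity)
  rw [← ha2]
  gcongr
  rwa [div_le_iff₀' (by positivity)]

/-! ### The ground-state level -/

lemma exists_inS {Θ : ℝ} (hΘ : 0 < Θ) : ∃ u : Pt → ℝ, inS Θ u := by
  let f : ContDiffBump (0 : Fin 3 → ℝ) := ⟨1, 2, one_pos, one_lt_two⟩
  have hf : ContDiff ℝ 1 f := f.contDiff
  have hfd : Differentiable ℝ f := hf.differentiable (by norm_num)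
  have hfs : HasCompactSupport f := f.hasCompactSupport
  have hInt : ∀ {h : (Fin 3 → ℝ) → ℝ}, Continuous h → HasCompactSupport h →
      IntegrableOn (fun p : Pt => h p.1) Dom := by
    intro h hc hs
    have : Integrable (fun p : Pt => h p.1) domMeasure := by
      rw [domMeasure_eq]
      exact (hc.integrable_of_hasCompactSupport hs).comp_fst _
    exact this
  have hpow : ∀ n : ℕ, n ≠ 0 → IntegrableOn (fun p : Pt => f p.1 ^ n) Dom := fun n hn =>
    hInt (h := fun x => f x ^ n) (hfd.continuous.pow n)
      (hfs.comp_left (g := fun a : ℝ => a ^ n) (zero_pow hn))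
  set w : Pt → ℝ := fun p => f p.1 with hw
  have hwd : ∀ p : Pt, HasFDerivAt w
      ((fderiv ℝ f p.1).comp (ContinuousLinearMap.fst ℝ (Fin 3 → ℝ) ℝ)) p := fun p =>
    (hfd p.1).hasFDerivAt.comp p hasFDerivAt_fst
  have hwH : ∀ c : ℝ, H1 fun p => c * w p := by
    intro c
    refine ⟨fun x y => rfl, fun p => ((hwd p).const_mul c).differentiableAt, ?_, ?_, ?_⟩
    · simp_rw [mul_pow]
      exact (hpow 2 two_ne_zero).const_mul _
    · have e : ∀ p, gradSq (fun q => c * w q) p =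
          c ^ 2 * ∑ i, (fderiv ℝ f p.1 (ex i).1) ^ 2 := by
        intro p
        have e' : ∀ d, fderiv ℝ (fun q => c * w q) p d = c * fderiv ℝ f p.1 d.1 :=
          fun d => by
            rw [((hwd p).const_mul c).fderiv]
            rfl
        simp [gradSq, gradSqX, gradx, grady, e', ey, mul_pow, Finset.mul_sum]
      simp_rw [e]
      refine (integrable_finsetSum _ fun i _ => ?_).const_mul _
      refine hInt (h := fun x => (fderiv ℝ f x (ex i).1) ^ 2) ?_ ?_
      · exact ((hf.continuous_fderiv one_ne_zero).clm_apply continuous_const).pow 2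
      · exact (hfs.fderiv (𝕜 := ℝ)).comp_left
          (g := fun L : (Fin 3 → ℝ) →L[ℝ] ℝ => L (ex i).1 ^ 2) (by simp)
    · simp_rw [mul_pow]
      exact (hpow 4 four_ne_zero).const_mul _
  have hpos : 0 < ∫ p in Dom, w p ^ 2 := by
    have e : ∫ p in Dom, w p ^ 2 = (2 * π) * ∫ x, f x ^ 2 := by
      change ∫ p, f p.1 ^ 2 ∂domMeasure = _
      rw [domMeasure_eq, integral_fun_fst (fun x => f x ^ 2)]
      simp [Measure.real, Real.pi_pos.le]
    rw [e]
    refine mul_pos Real.two_pi_pos ?_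
    refine (hfd.continuous.pow 2).integral_pos_of_hasCompactSupport_nonneg_nonzero (x := 0)
      (hfs.comp_left (g := fun a : ℝ => a ^ 2) (zero_pow two_ne_zero))
      (fun x => sq_nonneg _) ?_
    have h1 : f 0 = 1 := f.one_of_mem_closedBall (by simp [f])
    simp [h1]
  refine ⟨fun p => Θ / √(∫ p in Dom, w p ^ 2) * w p, hwH _, ?_⟩
  rw [l2]
  simp_rw [mul_pow]
  rw [integral_const_mul, div_pow, Real.sq_sqrt hpos.le, div_mul_cancel₀ _ hpos.ne',
    Real.sqrt_sq hΘ.le]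

lemma exists_svirial_eq_zero {Θ : ℝ} (hΘ : 0 < Θ) :
    ∃ u v : Pt → ℝ, inS Θ u ∧ inS Θ v ∧ svirial u v = 0 := by
  obtain ⟨u, hu⟩ := exists_inS hΘ
  have hX := hu.horizontal_pos hΘ hu
  have hN : 0 < quartic u u := by
    have e : quartic u u = 4 * ∫ p in Dom, u p ^ 4 := by
      rw [quartic, ← integral_const_mul]
      congr 1
      ext p
      rw [nonlin]
      ring
    rw [e]
    linarith [hu.integral_pow_four_pos hΘ]
  have hτ : 0 < 4 * horizontal u u / (3 * quartic u u) := by positivity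
  refine ⟨_, _, hu.scaleX hτ, hu.scaleX hτ, ?_⟩
  rw [svirial_scaleX hu.1 hu.1 hτ, ← horizontal, ← quartic]
  field_simp
  ring

lemma exists_energy_lt_of_mlevel_lt {Θ c : ℝ} (hΘ : 0 < Θ) (hc : mlevel Θ < c) :
    ∃ u v : Pt → ℝ, inS Θ u ∧ inS Θ v ∧ svirial u v = 0 ∧ energy u v < c := by
  obtain ⟨u, v, hu, hv, h⟩ := exists_svirial_eq_zero hΘ
  obtain ⟨_, ⟨u, v, hu, hv, h, rfl⟩, hlt⟩ := exists_lt_of_csInf_lt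
    (by exact ⟨_, u, v, hu, hv, h, rfl⟩) hc
  exact ⟨u, v, hu, hv, h, hlt⟩

lemma mlevel_le_energy {Θ : ℝ} (hΘ : 0 < Θ) {u v : Pt → ℝ} (hu : inS Θ u) (hv : inS Θ v)
    (h : svirial u v = 0) : mlevel Θ ≤ energy u v := by
  refine csInf_le ⟨0, ?_⟩ ⟨u, v, hu, hv, h, rfl⟩
  rintro _ ⟨u, v, hu, hv, h, rfl⟩
  rw [hu.energy_of_svirial_eq_zero hv h]
  linarith [hu.horizontal_pos hΘ hv, vertical_nonneg u v]

lemma mlevel_pos {Θ : ℝ} (hΘ : 0 < Θ) : 0 < mlevel Θ := by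
  obtain ⟨κ, hκ, hb⟩ := exists_pos_le_horizontal (M := 1) hΘ
  by_contra! hm
  obtain ⟨u, v, hu, hv, h, hlt⟩ := exists_energy_lt_of_mlevel_lt hΘ
    (hm.trans_lt (lt_min (by positivity : 0 < κ / 6) (by norm_num : (0 : ℝ) < 1 / 2)))
  rw [hu.energy_of_svirial_eq_zero hv h, lt_min_iff] at hlt
  have hX := hu.horizontal_pos hΘ hv
  have := hb u v hu hv (by linarith) h.le
  linarith [vertical_nonneg u v]

/-! ### The mountain-pass level -/

lemma le_pathMax {Θ k ε : ℝ} {g : ℝ → (Pt → ℝ) × (Pt → ℝ)} (hg : g ∈ Gam Θ k ε) {t : ℝ}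
    (ht : t ∈ Set.Icc (0 : ℝ) 1) : energy (g t).1 (g t).2 ≤ pathMax g := by
  have hc := (hg.1.continuousOn_functionals fun t ht =>
    ⟨(hg.2.1 t ht).1.1, (hg.2.1 t ht).2.1⟩).1
  obtain ⟨B, hB⟩ := isCompact_Icc.bddAbove_image hc
  refine le_csSup ⟨B, ?_⟩ ⟨t, ht, rfl⟩
  rintro _ ⟨s, hs, rfl⟩
  exact hB (Set.mem_image_of_mem _ hs)

lemma mlevel_le_pathMax {Θ k ε : ℝ} (hΘ : 0 < Θ)
    (hA : ∀ uv ∈ Aset Θ k ε, 0 ≤ svirial uv.1 uv.2) {g : ℝ → (Pt → ℝ) × (Pt → ℝ)}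
    (hg : g ∈ Gam Θ k ε) : mlevel Θ ≤ pathMax g := by
  have hc := (hg.1.continuousOn_functionals fun t ht =>
    ⟨(hg.2.1 t ht).1.1, (hg.2.1 t ht).2.1⟩).2
  have h1 : svirial (g 1).1 (g 1).2 ≤ 0 := by
    obtain ⟨hu, hv⟩ := hg.2.1 1 (by simp)
    have he := hg.2.2.2
    rw [hu.1.energy_eq_functionals hv.1] at he
    rw [hu.1.svirial_eq_functionals hv.1]
    linarith [hu.horizontal_pos hΘ hv, vertical_nonneg (g 1).1 (g 1).2]
  obtain ⟨t, ht, hQ⟩ := intermediate_value_Icc' zero_le_one hc ⟨h1, hA _ hg.2.2.1⟩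
  exact (mlevel_le_energy hΘ (hg.2.1 t ht).1 (hg.2.1 t ht).2 hQ).trans (le_pathMax hg ht)

lemma exists_path_of_svirial_eq_zero {Θ k ε : ℝ} (hΘ : 0 < Θ) (hk : 0 < k) {u v : Pt → ℝ}
    (hu : inS Θ u) (hv : inS Θ v) (h : svirial u v = 0)
    (hY : vertical u v ≤ 2 * (mlevel Θ - ε)) :
    ∃ g ∈ Gam Θ k ε, pathMax g ≤ energy u v := by
  have hX := hu.horizontal_pos hΘ hv
  have hY0 := vertical_nonneg u v
  have hN := h
  rw [hu.1.svirial_eq_functionals hv.1] at hN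
  set X := horizontal u v with hXdef
  set Y := vertical u v with hYdef
  have hE : ∀ s : ℝ, 0 < s → energy (scaleX s u) (scaleX s v) =
      X * (s ^ 2 / 2 - s ^ 3 / 3) + Y / 2 := fun s hs => by
    rw [energy_scaleX hu.1 hv.1 hs, ← horizontal, ← vertical, ← quartic, ← hXdef, ← hYdef,
      show quartic u v = 4 / 3 * X by linarith]
    ring
  set a := k / (k + X + 1) with ha
  set b := 3 + Y / X with hb
  have ha0 : 0 < a := by positivity
  have hb0 : 0 < b := by positivity
  set τ : ℝ → ℝ := fun t => (1 - t) * a + t * b with hτ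
  have hτpos : ∀ t ∈ Set.Icc (0 : ℝ) 1, 0 < τ t := by
    intro t ht
    have hmin := lt_min ha0 hb0
    have h1 := mul_le_mul_of_nonneg_left (min_le_left a b) (sub_nonneg.2 ht.2)
    have h2 := mul_le_mul_of_nonneg_left (min_le_right a b) ht.1
    simp only [hτ]
    linarith
  have hτc : Continuous τ := by fun_prop
  have hτ0 : τ 0 = a := by simp [hτ]
  have hτ1 : τ 1 = b := by simp [hτ]
  have hcont : ∀ {w : Pt → ℝ}, H1 w → ∀ t ∈ Set.Icc (0 : ℝ) 1, ∀ η : ℝ, 0 < η →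
      ∃ δ > 0, ∀ s, |s - t| < δ → h1dist (scaleX (τ s) w) (scaleX (τ t) w) < η := by
    intro w hw t ht η hη
    have hl := (hw.tendsto_h1dist_scaleX (hτpos t ht)).comp (hτc.tendsto t)
    obtain ⟨δ, hδ, hd⟩ := Metric.eventually_nhds_iff.1 (hl.eventually (gt_mem_nhds hη))
    exact ⟨δ, hδ, fun s hs => hd hs⟩
  refine ⟨fun t => (scaleX (τ t) u, scaleX (τ t) v), ⟨?_, ?_, ?_, ?_⟩, ?_⟩
  · intro t ht η hη
    obtain ⟨δ₁, h₁, d₁⟩ := hcont hu.1 t ht η hη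
    obtain ⟨δ₂, h₂, d₂⟩ := hcont hv.1 t ht η hη
    exact ⟨min δ₁ δ₂, lt_min h₁ h₂, fun s _ hst =>
      ⟨d₁ s (hst.trans_le (min_le_left _ _)), d₂ s (hst.trans_le (min_le_right _ _))⟩⟩
  · exact fun t ht => ⟨hu.scaleX (hτpos t ht), hv.scaleX (hτpos t ht)⟩
  · simp only [hτ0]
    refine ⟨hu.scaleX ha0, hv.scaleX ha0, ?_, ?_⟩
    · simp only [hu.1.integral_gradSqX_scaleX ha0, hv.1.integral_gradSqX_scaleX ha0]
      rw [← mul_add, ← horizontal, ← hXdef]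
      have ha1 : a ≤ 1 := (div_le_one (by positivity)).2 (by linarith)
      have haX : a * (k + X + 1) = k := div_mul_cancel₀ _ (by positivity)
      nlinarith [mul_nonneg (mul_nonneg ha0.le (sub_nonneg.2 ha1)) hX.le]
    · simp only [hu.1.integral_grady_scaleX ha0, hv.1.integral_grady_scaleX ha0]
      exact hY
  · simp only [hτ1]
    rw [hE b hb0]
    have hXb : X * b = 3 * X + Y := by rw [hb]; field_simp
    have hb3 : 3 ≤ b := by rw [hb]; linarith [div_nonneg hY0 hX.le]
    have e : X * (b ^ 2 / 2 - b ^ 3 / 3) = -((X * b) * (b * (b / 3 - 1 / 2))) := by ring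
    have h1 : 1 ≤ b * (b / 3 - 1 / 2) := by nlinarith
    have h2 : 0 < 3 * X + Y := by linarith
    rw [e, hXb]
    nlinarith [mul_le_mul_of_nonneg_left h1 h2.le]
  · refine csSup_le ⟨_, 0, by simp, rfl⟩ ?_
    rintro _ ⟨t, ht, rfl⟩
    have hs := hτpos t ht
    simp only [hE _ hs, hu.energy_of_svirial_eq_zero hv h, ← hXdef, ← hYdef]
    have : 0 ≤ X * ((τ t - 1) ^ 2 * (2 * τ t + 1)) := by positivity
    nlinarith

/-- `I` has a mountain-pass geometry on `S_Θ × S_Θ` at level `m_Θ`: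
there are `k > 0` and `ε ∈ (0, m_Θ)` with `γ_Θ = m_Θ` and
`γ_Θ > max{sup_g I(g(0)), sup_g I(g(1))}`. -/
theorem mountain_pass_geometry (Θ : ℝ) (hΘ : 0 < Θ) :
    ∃ k ε : ℝ, 0 < k ∧ 0 < ε ∧ ε < mlevel Θ ∧
      gammaLevel Θ k ε = mlevel Θ ∧
      sSup {c | ∃ g ∈ Gam Θ k ε, energy (g 0).1 (g 0).2 = c} < gammaLevel Θ k ε ∧
      sSup {c | ∃ g ∈ Gam Θ k ε, energy (g 1).1 (g 1).2 = c} < gammaLevel Θ k ε := by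
  have hm := mlevel_pos hΘ
  set m := mlevel Θ with hmdef
  obtain ⟨κ, hκ, hb⟩ := exists_pos_le_horizontal (M := 2 * m + 2) hΘ
  obtain ⟨ε, hε, hεm⟩ := exists_between
    (show 0 < min (m / 2) (min (κ / 12) 1) by positivity)
  simp only [lt_min_iff] at hεm
  obtain ⟨hεm, hεκ, hε1⟩ := hεm
  have hA : ∀ uv ∈ Aset Θ ε ε, 0 ≤ svirial uv.1 uv.2 := by
    rintro ⟨u, v⟩ ⟨hu, hv, hX, hY⟩
    by_contra! hQ
    have := hb u v hu hv (hY.trans (by linarith)) hQ.le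
    have hX' : horizontal u v < ε := hX
    linarith
  have hpath : ∀ η, 0 < η → η < ε → ∃ g ∈ Gam Θ ε ε, pathMax g ≤ m + η := by
    intro η hη hηε
    obtain ⟨u, v, hu, hv, hQ, hE⟩ := exists_energy_lt_of_mlevel_lt hΘ
      (show mlevel Θ < m + η by linarith)
    have hE' := hE
    rw [hu.energy_of_svirial_eq_zero hv hQ] at hE'
    have hX := hu.horizontal_pos hΘ hv
    have hκX := hb u v hu hv (by linarith) hQ.le
    obtain ⟨g, hg, hgm⟩ := exists_path_of_svirial_eq_zero hΘ hε hu hv hQ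
      (show vertical u v ≤ 2 * (mlevel Θ - ε) by linarith)
    exact ⟨g, hg, hgm.trans hE.le⟩
  obtain ⟨g₀, hg₀, -⟩ := hpath (ε / 2) (by linarith) (by linarith)
  have hγ : gammaLevel Θ ε ε = m := by
    apply le_antisymm
    · refine le_of_forall_pos_lt_add fun η hη => ?_
      obtain ⟨g, hg, hgm⟩ := hpath (min (η / 2) (ε / 2)) (by positivity)
        ((min_le_right _ _).trans_lt (by linarith))
      refine (csInf_le ⟨m, ?_⟩ (by exact ⟨g, hg, rfl⟩)).trans_lt
        (hgm.trans_lt (by linarith [min_le_left (η / 2) (ε / 2)]))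
      rintro _ ⟨g, hg, rfl⟩
      exact mlevel_le_pathMax hΘ hA hg
    · refine le_csInf (by exact ⟨_, g₀, hg₀, rfl⟩) ?_
      rintro _ ⟨g, hg, rfl⟩
      exact mlevel_le_pathMax hΘ hA hg
  refine ⟨ε, ε, hε, hε, by linarith, hγ, ?_, ?_⟩
  · rw [hγ]
    refine (csSup_le (a := m - ε / 2) (by exact ⟨_, g₀, hg₀, rfl⟩) ?_).trans_lt (by linarith)
    rintro _ ⟨g, hg, rfl⟩
    obtain ⟨hu, hv, hX, hY⟩ := hg.2.2.1
    have hX' : horizontal (g 0).1 (g 0).2 < ε := hX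
    have hY' : vertical (g 0).1 (g 0).2 ≤ 2 * (m - ε) := hY
    rw [hu.1.energy_eq_functionals hv.1]
    linarith [quartic_nonneg (g 0).1 (g 0).2]
  · rw [hγ]
    refine (csSup_le (a := 0) (by exact ⟨_, g₀, hg₀, rfl⟩) ?_).trans_lt hm
    rintro _ ⟨g, hg, rfl⟩
    exact hg.2.2.2.le

end Waveguide
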